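/- Let n ≥ 2, s ∈ (0,1) and let ε₀ = ε₀(n,s) > 0 be such that minimizers of min{ P_s(E) + ε V_s(E) : |E| = ω_n } exist for ε ∈ (0, ε₀]. Then there exists a constant γ(n,s) > 0 such that for every ε ∈ (0, ε₀] and every minimizer E_ε, there exists x_ε ∈ ℝⁿ with |(E_ε − x_ε) Δ B₁| ≤ γ(n,s) ε^{1/2}, where B₁ is the unit ball centered at the origin. -/

import Mathlib

open MeasureTheory Metric Set Filter
open scoped ENNReal NNReal symmDiff Topology

noncomputable section

/-- The ambient Euclidean space `ℝⁿ`. -/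
abbrev Rn (n : ℕ) := EuclideanSpace ℝ (Fin n)

/-- The fractional `s`-perimeter `P_s(E) = ∫_E ∫_{Eᶜ} |x-y|^{-(n+s)} dx dy`. -/
def fracPer (n : ℕ) (s : ℝ) (E : Set (Rn n)) : ℝ≥0∞ :=
  ∫⁻ x in E, ∫⁻ y in Eᶜ, ENNReal.ofReal (‖x - y‖ ^ (-((n : ℝ) + s)))

/-- The Riesz-type potential `∫_E |x-y|^{-s} dx` of `E` evaluated at `y`. -/
def rieszAt (n : ℕ) (s : ℝ) (E : Set (Rn n)) (y : Rn n) : ℝ≥0∞ :=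
  ∫⁻ x in E, ENNReal.ofReal (‖x - y‖ ^ (-s))

/-- `V_s(E) = max_{y ∈ ℝⁿ} ∫_E |x-y|^{-s} dx`. -/
def Vs (n : ℕ) (s : ℝ) (E : Set (Rn n)) : ℝ≥0∞ := ⨆ y : Rn n, rieszAt n s E y

/-- `ω_n`, the volume of the unit ball of `ℝⁿ`. -/
def unitBallVol (n : ℕ) : ℝ := (volume (ball (0 : Rn n) 1)).toReal

/-- The radius `r` such that `|B_r| = |E|`. -/
def ballRad (n : ℕ) (E : Set (Rn n)) : ℝ :=
  ((volume E).toReal / unitBallVol n) ^ ((1 : ℝ) / n)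

/-- The fractional isoperimetric deficit `δ_s(E) = (P_s(E) - P_s(B_r))/P_s(B_r)`,
where `|B_r| = |E|`. -/
def fracDeficit (n : ℕ) (s : ℝ) (E : Set (Rn n)) : ℝ :=
  ((fracPer n s E).toReal - (fracPer n s (ball (0 : Rn n) (ballRad n E))).toReal) /
    (fracPer n s (ball (0 : Rn n) (ballRad n E))).toReal

/-- The normalization constant `c_{n,s} = P_s(B₁)(n-s)/(n ω_n)`. -/
def cns (n : ℕ) (s : ℝ) : ℝ :=
  (fracPer n s (ball (0 : Rn n) 1)).toReal * ((n : ℝ) - s) / (n * unitBallVol n)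

/-- The strong asymmetry index
`A_s(E) = min_y { |E Δ B_r(y)|/|B_r| + ((P_s(E) - c_{n,s} ∫_E |x-y|^{-s} dx)/P_s(B_r))^{1/2} }`,
with `|B_r| = |E|`. -/
def asymA (n : ℕ) (s : ℝ) (E : Set (Rn n)) : ℝ :=
  ⨅ y : Rn n,
    ((volume (E ∆ ball y (ballRad n E))).toReal /
        (volume (ball (0 : Rn n) (ballRad n E))).toReal +
      Real.sqrt (((fracPer n s E).toReal - cns n s * (rieszAt n s E y).toReal) /
        (fracPer n s (ball (0 : Rn n) (ballRad n E))).toReal))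

/-- The oscillation index `β_s(E) = ((P_s(E) - c_{n,s} V_s(E))/P_s(B_r))^{1/2}`,
with `|B_r| = |E|`. -/
def betaS (n : ℕ) (s : ℝ) (E : Set (Rn n)) : ℝ :=
  Real.sqrt (((fracPer n s E).toReal - cns n s * (Vs n s E).toReal) /
    (fracPer n s (ball (0 : Rn n) (ballRad n E))).toReal)

/-- The asymmetry index `ζ_s(E) = (V_s(B_r) - V_s(E))/V_s(B_r)`, with `|B_r| = |E|`. -/
def zetaS (n : ℕ) (s : ℝ) (E : Set (Rn n)) : ℝ :=
  ((Vs n s (ball (0 : Rn n) (ballRad n E))).toReal - (Vs n s E).toReal) /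
    (Vs n s (ball (0 : Rn n) (ballRad n E))).toReal

/-- The Fraenkel asymmetry `α(E) = min_y |E Δ B_r(y)|/|B_r|`, with `|B_r| = |E|`. -/
def fraenkel (n : ℕ) (E : Set (Rn n)) : ℝ :=
  ⨅ y : Rn n, (volume (E ∆ ball y (ballRad n E))).toReal /
    (volume (ball (0 : Rn n) (ballRad n E))).toReal

/-- The fractional Cheeger constant `h_{m,s}(Ω) = inf { P_s(E)/|E|^m : E ⊆ Ω }`. -/
def cheeger (n : ℕ) (m s : ℝ) (Ω : Set (Rn n)) : ℝ :=
  sInf {x : ℝ | ∃ E : Set (Rn n), E ⊆ Ω ∧ MeasurableSet E ∧ 0 < volume E ∧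
    x = (fracPer n s E).toReal / (volume E).toReal ^ m}

/-- The energy functional `E_s(E) = P_s(E) + ε V_s(E)`. -/
def energy (n : ℕ) (s ε : ℝ) (E : Set (Rn n)) : ℝ≥0∞ :=
  fracPer n s E + ENNReal.ofReal ε * Vs n s E

/-- The generalized energy functional `Ẽ_s({E^k}) = Σ_k E_s(E^k)`. -/
def genEnergy (n : ℕ) (s ε : ℝ) (F : ℕ → Set (Rn n)) : ℝ≥0∞ :=
  ∑' k : ℕ, energy n s ε (F k)

/-- Absolute difference in `ℝ≥0∞` (equal to `|a - b|` for finite values). -/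
def ennAbsDiff (a b : ℝ≥0∞) : ℝ≥0∞ := (a - b) + (b - a)

/-- The penalized generalized functional `Ẽ_{s,Λ}({E^k}) = Ẽ_s({E^k}) + Λ |Σ_k |E^k| - ω_n|`. -/
def penEnergy (n : ℕ) (s ε Λ : ℝ) (F : ℕ → Set (Rn n)) : ℝ≥0∞ :=
  genEnergy n s ε F +
    ENNReal.ofReal Λ * ennAbsDiff (∑' k : ℕ, volume (F k)) (volume (ball (0 : Rn n) 1))

/-- `E` is a minimizer of `min { P_s(E) + ε V_s(E) : E ⊆ ℝⁿ measurable, |E| = ω_n }`. -/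
def IsEnergyMin (n : ℕ) (s ε : ℝ) (E : Set (Rn n)) : Prop :=
  MeasurableSet E ∧ volume E = volume (ball (0 : Rn n) 1) ∧
    ∀ F : Set (Rn n), MeasurableSet F → volume F = volume (ball (0 : Rn n) 1) →
      energy n s ε E ≤ energy n s ε F

/-- The interaction `∬_{A × B} k(|x - y|) dx dy` of two sets. -/
def interaction {n : ℕ} (k : ℝ → ℝ≥0∞) (A B : Set (Rn n)) : ℝ≥0∞ :=
  ∫⁻ p in A ×ˢ B, k ‖p.1 - p.2‖ ∂(volume.prod volume)

theorem measurable_kernel {n : ℕ} {k : ℝ → ℝ≥0∞} (hk : Measurable k) :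
    Measurable fun p : Rn n × Rn n => k ‖p.1 - p.2‖ :=
  hk.comp (measurable_fst.sub measurable_snd).norm

theorem interaction_eq_iterated {n : ℕ} {k : ℝ → ℝ≥0∞} (hk : Measurable k) (A B : Set (Rn n)) :
    interaction k A B = ∫⁻ x in A, ∫⁻ y in B, k ‖x - y‖ := by
  rw [interaction, ← Measure.prod_restrict, lintegral_prod _ (measurable_kernel hk).aemeasurable]

/-- The data of a reflection of `ℝⁿ` across a hyperplane bounding the half-space `H`. -/
structure IsHalfSpaceReflection {n : ℕ} (σ : Rn n → Rn n) (H : Set (Rn n)) : Prop where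
  measurePreserving : MeasurePreserving σ volume volume
  involutive : ∀ x, σ (σ x) = x
  norm_sub : ∀ x y, ‖σ x - σ y‖ = ‖x - y‖
  measurableSet : MeasurableSet H
  mem_or : ∀ x, x ∈ H ∨ σ x ∈ H
  eq_self : ∀ x ∈ H, σ x ∈ H → σ x = x
  norm_sub_le : ∀ x ∈ H, ∀ y ∈ H, ‖x - y‖ ≤ ‖x - σ y‖

/-- The polarization (two-point symmetrization) of `E` towards the half-space `H`. -/
def polarization {n : ℕ} (σ : Rn n → Rn n) (H E : Set (Rn n)) : Set (Rn n) :=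
  {x | (x ∈ H ∧ (x ∈ E ∨ σ x ∈ E)) ∨ (x ∈ E ∧ σ x ∈ E)}

namespace IsHalfSpaceReflection

variable {n : ℕ} {σ : Rn n → Rn n} {H E : Set (Rn n)}

theorem mem_polarization {x : Rn n} (hx : x ∈ H) :
    x ∈ polarization σ H E ↔ x ∈ E ∨ σ x ∈ E := by
  simp only [polarization, mem_ofPred_eq]; tauto

theorem apply_mem_polarization (h : IsHalfSpaceReflection σ H) {x : Rn n} (hx : x ∈ H) :
    σ x ∈ polarization σ H E ↔ x ∈ E ∧ σ x ∈ E := by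
  simp only [polarization, mem_ofPred_eq, h.involutive]
  by_cases h' : σ x ∈ H
  · rw [h.eq_self x hx h']; tauto
  · tauto

theorem measurableSet_polarization (h : IsHalfSpaceReflection σ H) (hE : MeasurableSet E) :
    MeasurableSet (polarization σ H E) := by
  have h1 : MeasurableSet (σ ⁻¹' E) := h.measurePreserving.measurable hE
  exact (h.measurableSet.inter (hE.union h1)).union (hE.inter h1)

theorem lintegral_add_comp (h : IsHalfSpaceReflection σ H) {f : Rn n → ℝ≥0∞} (hf : Measurable f) :
    ∫⁻ x, (f x + f (σ x)) = 2 * ∫⁻ x, f x := by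
  rw [lintegral_add_left hf, h.measurePreserving.lintegral_comp hf, two_mul]

theorem volume_polarization (h : IsHalfSpaceReflection σ H) (hE : MeasurableSet E) :
    volume (polarization σ H E) = volume E := by
  have h1 := h.lintegral_add_comp (f := (polarization σ H E).indicator 1)
    (measurable_one.indicator (h.measurableSet_polarization hE))
  have h2 := h.lintegral_add_comp (f := E.indicator 1) (measurable_one.indicator hE)
  rw [lintegral_indicator_one (h.measurableSet_polarization hE)] at h1
  rw [lintegral_indicator_one hE] at h2
  have key : ∀ x ∈ H, (polarization σ H E).indicator (1 : Rn n → ℝ≥0∞) x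
      + (polarization σ H E).indicator 1 (σ x) = E.indicator 1 x + E.indicator 1 (σ x) := by
    intro x hx
    classical
    have e1 := mem_polarization (σ := σ) (E := E) hx
    have e2 := h.apply_mem_polarization (E := E) hx
    simp only [indicator_apply, e1, e2, Pi.one_apply]
    by_cases a : x ∈ E <;> by_cases b : σ x ∈ E <;> simp [a, b]
  have : ∀ x, (polarization σ H E).indicator (1 : Rn n → ℝ≥0∞) x
      + (polarization σ H E).indicator 1 (σ x) = E.indicator 1 x + E.indicator 1 (σ x) := by
    intro x
    rcases h.mem_or x with hx | hx
    · exact key x hx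
    · have := key _ hx
      rw [h.involutive] at this
      rw [add_comm, this, add_comm]
  rw [lintegral_congr this, h2] at h1
  exact ((ENNReal.mul_right_inj (by simp) (by simp)).1 h1).symm

/-- Polarization increases the overlap with a set `B` that is favoured by the half-space. -/
theorem volume_inter_add_le (h : IsHalfSpaceReflection σ H) (hE : MeasurableSet E)
    {B : Set (Rn n)} (hB : MeasurableSet B) (hBH : ∀ x ∈ H, σ x ∈ B → x ∈ B) :
    volume (E ∩ B) + volume ((B \ E) ∩ σ ⁻¹' (E \ B)) ≤ volume (polarization σ H E ∩ B) := by
  have hP := h.measurableSet_polarization hE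
  set S := (B \ E) ∩ σ ⁻¹' (E \ B) with hS
  have hSm : MeasurableSet S :=
    (hB.diff hE).inter (h.measurePreserving.measurable (hE.diff hB))
  have m1 : Measurable (fun x => (E ∩ B).indicator (1 : Rn n → ℝ≥0∞) x + S.indicator 1 x) :=
    (measurable_one.indicator (hE.inter hB)).add (measurable_one.indicator hSm)
  have h1 := h.lintegral_add_comp m1
  have h2 := h.lintegral_add_comp (f := (polarization σ H E ∩ B).indicator 1)
    (measurable_one.indicator (hP.inter hB))
  rw [lintegral_indicator_one (hP.inter hB)] at h2
  rw [lintegral_add_left (measurable_one.indicator (hE.inter hB)),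
    lintegral_indicator_one (hE.inter hB), lintegral_indicator_one hSm] at h1
  have key : ∀ x ∈ H, ((E ∩ B).indicator (1 : Rn n → ℝ≥0∞) x + S.indicator 1 x)
      + ((E ∩ B).indicator (1 : Rn n → ℝ≥0∞) (σ x) + S.indicator 1 (σ x))
      ≤ (polarization σ H E ∩ B).indicator 1 x + (polarization σ H E ∩ B).indicator 1 (σ x) := by
    intro x hx
    classical
    have e1 := mem_polarization (σ := σ) (E := E) hx
    have e2 := h.apply_mem_polarization (E := E) hx
    have e3 := hBH x hx
    simp only [indicator_apply, mem_inter_iff, e1, e2, Pi.one_apply, hS, mem_preimage,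
      Set.mem_sdiff,
      h.involutive]
    clear e1 e2 h1 h2 m1 hSm
    generalize (x ∈ E) = P at *
    generalize (σ x ∈ E) = Q at *
    generalize (x ∈ B) = R at *
    generalize (σ x ∈ B) = S at *
    by_cases a : P <;> by_cases b : Q <;> by_cases c : R <;> by_cases d : S <;>
      simp_all only [and_true, and_false, not_true, not_false_iff, if_true, if_false, or_true,
        or_false, add_zero, zero_add, le_refl, imp_false, true_imp_iff, false_imp_iff]
  have : 2 * (volume (E ∩ B) + volume S) ≤ 2 * volume (polarization σ H E ∩ B) := by
    rw [← h1, ← h2]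
    refine lintegral_mono fun x => ?_
    rcases h.mem_or x with hx | hx
    · exact key x hx
    · have := key _ hx
      rw [h.involutive] at this
      rwa [add_comm, add_comm (indicator (polarization σ H E ∩ B) _ x)]
  exact (ENNReal.mul_le_mul_iff_right (by simp) (by simp)).1 this

theorem interaction_le (h : IsHalfSpaceReflection σ H) (hE : MeasurableSet E)
    {k : ℝ → ℝ≥0∞} (hk : Antitone k) :
    interaction k E E ≤ interaction k (polarization σ H E) (polarization σ H E) := by
  have hP := h.measurableSet_polarization hE
  have hσ := h.measurePreserving
  set w : Set (Rn n) → Rn n × Rn n → ℝ≥0∞ :=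
    fun A => (A ×ˢ A).indicator fun p => k ‖p.1 - p.2‖ with hw
  have wm : ∀ {A : Set (Rn n)}, MeasurableSet A → Measurable (w A) := fun hA =>
    (measurable_kernel hk.measurable).indicator (hA.prod hA)
  have sum_eq : ∀ {A : Set (Rn n)}, MeasurableSet A →
      ∫⁻ p : Rn n × Rn n, (w A p + w A (σ p.1, σ p.2) + (w A (p.1, σ p.2) + w A (σ p.1, p.2)))
        ∂(volume.prod volume) = 4 * interaction k A A := by
    intro A hA
    have i0 : interaction k A A = ∫⁻ p, w A p ∂(volume.prod volume) :=
      (lintegral_indicator (hA.prod hA) _).symm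
    have i1 := (hσ.prod hσ).lintegral_comp (wm hA)
    have i2 := ((MeasurePreserving.id (volume : Measure (Rn n))).prod hσ).lintegral_comp (wm hA)
    have i3 := (hσ.prod (MeasurePreserving.id (volume : Measure (Rn n)))).lintegral_comp (wm hA)
    have m1 : Measurable fun p : Rn n × Rn n => w A (σ p.1, σ p.2) :=
      (wm hA).comp (hσ.prod hσ).measurable
    have m2 : Measurable fun p : Rn n × Rn n => w A (p.1, σ p.2) := (wm hA).comp
      ((MeasurePreserving.id (volume : Measure (Rn n))).prod hσ).measurable
    simp only [Prod.map, id] at i1 i2 i3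
    rw [lintegral_add_left (f := fun p => w A p + w A (σ p.1, σ p.2)) ((wm hA).add m1),
      lintegral_add_left (wm hA), lintegral_add_left m2,
      i1, i2, i3, ← i0]
    ring
  have key : ∀ x ∈ H, ∀ y ∈ H,
      w E (x, y) + w E (σ x, σ y) + (w E (x, σ y) + w E (σ x, y)) ≤
      w (polarization σ H E) (x, y) + w (polarization σ H E) (σ x, σ y) +
        (w (polarization σ H E) (x, σ y) + w (polarization σ H E) (σ x, y)) := by
    intro x hx y hy
    classical
    have e1 := mem_polarization (σ := σ) (E := E) hx
    have e2 := h.apply_mem_polarization (E := E) hx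
    have e3 := mem_polarization (σ := σ) (E := E) hy
    have e4 := h.apply_mem_polarization (E := E) hy
    have n1 : ‖σ x - σ y‖ = ‖x - y‖ := h.norm_sub x y
    have n2 : ‖σ x - y‖ = ‖x - σ y‖ := by
      have := h.norm_sub x (σ y)
      rwa [h.involutive] at this
    have hab : k ‖x - σ y‖ ≤ k ‖x - y‖ := hk (h.norm_sub_le x hx y hy)
    simp only [hw, indicator_apply, mem_prod, e1, e2, e3, e4, n1, n2]
    generalize k ‖x - σ y‖ = b at *
    generalize k ‖x - y‖ = a at *
    by_cases c1 : x ∈ E <;> by_cases c2 : σ x ∈ E <;> by_cases c3 : y ∈ E <;>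
      by_cases c4 : σ y ∈ E <;>
      simp only [c1, c2, c3, c4, hab, and_true, and_false, if_true, if_false,
        or_true, or_false, add_zero, zero_add, le_refl]
  have key2 : ∀ p : Rn n × Rn n,
      w E p + w E (σ p.1, σ p.2) + (w E (p.1, σ p.2) + w E (σ p.1, p.2)) ≤
      w (polarization σ H E) p + w (polarization σ H E) (σ p.1, σ p.2) +
        (w (polarization σ H E) (p.1, σ p.2) + w (polarization σ H E) (σ p.1, p.2)) := by
    rintro ⟨x, y⟩
    rcases h.mem_or x with hx | hx <;> rcases h.mem_or y with hy | hy <;>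
      have := key _ hx _ hy <;> try simp only [h.involutive] at this
    · exact this
    · calc _ = _ := by ring
        _ ≤ _ := this
        _ = _ := by ring
    · calc _ = _ := by ring
        _ ≤ _ := this
        _ = _ := by ring
    · calc _ = _ := by ring
        _ ≤ _ := this
        _ = _ := by ring
  have : 4 * interaction k E E
      ≤ 4 * interaction k (polarization σ H E) (polarization σ H E) := by
    rw [← sum_eq hE, ← sum_eq hP]
    exact lintegral_mono key2
  exact (ENNReal.mul_le_mul_iff_right (by simp) (by simp)).1 this

end IsHalfSpaceReflection

/-- Reflection across the hyperplane `⟪e, ·⟫ = t`. -/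
def hyperplaneReflection {n : ℕ} (e : Rn n) (t : ℝ) (x : Rn n) : Rn n :=
  x - (2 * (inner ℝ e x - t)) • e

theorem continuous_hyperplaneReflection {n : ℕ} :
    Continuous fun p : Rn n × ℝ × Rn n => hyperplaneReflection p.1 p.2.1 p.2.2 := by
  unfold hyperplaneReflection
  fun_prop

theorem hyperplaneReflection_neg {n : ℕ} (e : Rn n) (t : ℝ) :
    hyperplaneReflection (-e) (-t) = hyperplaneReflection e t := by
  ext1 x
  simp only [hyperplaneReflection, inner_neg_left, smul_neg, ← neg_smul]
  congr 2
  ring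

theorem inner_hyperplaneReflection {n : ℕ} {e : Rn n} (he : ‖e‖ = 1) (t : ℝ) (x : Rn n) :
    inner ℝ e (hyperplaneReflection e t x) = 2 * t - inner ℝ e x := by
  rw [hyperplaneReflection, inner_sub_right, real_inner_smul_right, real_inner_self_eq_norm_sq, he]
  ring

theorem norm_sub_hyperplaneReflection_sq {n : ℕ} {e : Rn n} (he : ‖e‖ = 1) (t : ℝ) (x y : Rn n) :
    ‖x - hyperplaneReflection e t y‖ ^ 2
      = ‖x - y‖ ^ 2 + 4 * (inner ℝ e x - t) * (inner ℝ e y - t) := by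
  have : x - hyperplaneReflection e t y = (x - y) + (2 * (inner ℝ e y - t)) • e := by
    rw [hyperplaneReflection]; abel
  rw [this, norm_add_sq_real, real_inner_smul_right, norm_smul, he, real_inner_comm e (x - y),
    inner_sub_right, Real.norm_eq_abs, mul_one, sq_abs]
  ring

theorem isHalfSpaceReflection_hyperplaneReflection {n : ℕ} {e : Rn n} (he : ‖e‖ = 1) (t : ℝ) :
    IsHalfSpaceReflection (hyperplaneReflection e t) {x | inner ℝ e x ≤ t} where
  measurePreserving := by
    have h1 : hyperplaneReflection e t = fun x => (2 * t) • e + (ℝ ∙ e)ᗮ.reflection x := by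
      ext1 x
      rw [Submodule.reflection_orthogonal_apply, Submodule.reflection_singleton_apply, he,
        hyperplaneReflection, mul_sub, sub_smul]
      simp [mul_smul, ofNat_smul_eq_nsmul]
      abel
    rw [h1]
    exact (measurePreserving_add_left volume _).comp
      (LinearIsometryEquiv.measurePreserving (ℝ ∙ e)ᗮ.reflection)
  involutive x := by
    have := inner_hyperplaneReflection he t x
    conv_lhs => rw [hyperplaneReflection, this, hyperplaneReflection]
    rw [sub_sub, ← add_smul]
    ring_nf
    simp
  norm_sub x y := by
    rw [← sq_eq_sq₀ (norm_nonneg _) (norm_nonneg _), norm_sub_hyperplaneReflection_sq he,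
      norm_sub_rev, norm_sub_hyperplaneReflection_sq he, inner_hyperplaneReflection he,
      norm_sub_rev x y]
    ring
  measurableSet := measurableSet_le (by fun_prop) measurable_const
  mem_or x := by
    simp only [mem_ofPred_eq, inner_hyperplaneReflection he]
    rcases le_total (inner ℝ e x) t with h | h
    · exact Or.inl h
    · exact Or.inr (by linarith)
  eq_self x hx hx' := by
    simp only [mem_ofPred_eq, inner_hyperplaneReflection he] at hx hx'
    have : inner ℝ e x - t = 0 := by linarith
    rw [hyperplaneReflection, this]
    simp
  norm_sub_le x hx y hy := by
    simp only [mem_ofPred_eq] at hx hy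
    rw [← sq_le_sq₀ (norm_nonneg _) (norm_nonneg _), norm_sub_hyperplaneReflection_sq he]
    nlinarith

theorem norm_le_norm_hyperplaneReflection {n : ℕ} {e : Rn n} (he : ‖e‖ = 1) {t : ℝ} (ht : 0 ≤ t)
    {x : Rn n} (hx : inner ℝ e x ≤ t) : ‖x‖ ≤ ‖hyperplaneReflection e t x‖ := by
  have := norm_sub_hyperplaneReflection_sq he t 0 x
  rw [zero_sub, norm_neg, zero_sub, norm_neg, inner_zero_right] at this
  rw [← sq_le_sq₀ (norm_nonneg _) (norm_nonneg _), this]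
  nlinarith

theorem lintegral_polar {n : ℕ} (hn : 0 < n) {f : Rn n → ℝ≥0∞} (hf : Measurable f) :
    ∫⁻ x, f x = ∫⁻ e : sphere (0 : Rn n) 1, ∫⁻ r in Ioi (0 : ℝ),
      ENNReal.ofReal (r ^ (n - 1)) * f (r • (e : Rn n)) ∂volume
      ∂(volume : Measure (Rn n)).toSphere := by
  have : Nonempty (Fin n) := ⟨⟨0, hn⟩⟩
  have h1 : ∫⁻ x, f x = ∫⁻ x : ({(0 : Rn n)}ᶜ : Set (Rn n)), f x.1 ∂(volume.comap Subtype.val) := by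
    rw [lintegral_subtype_comap (measurableSet_singleton _).compl, restrict_compl_singleton]
  have mp := (volume : Measure (Rn n)).measurePreserving_homeomorphUnitSphereProd
  have h2 := mp.symm (homeomorphUnitSphereProd (Rn n)).toMeasurableEquiv |>.lintegral_comp
    (f := fun x : ({(0 : Rn n)}ᶜ : Set (Rn n)) => f x.1) (hf.comp measurable_subtype_coe)
  have hm : Measurable fun a : sphere (0 : Rn n) 1 × Ioi (0 : ℝ) =>
      f ((homeomorphUnitSphereProd (Rn n)).toMeasurableEquiv.symm a).1 :=
    hf.comp (measurable_subtype_coe.comp (MeasurableEquiv.measurable _))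
  rw [h1, ← h2, lintegral_prod _ hm.aemeasurable]
  refine lintegral_congr fun e => ?_
  rw [Measure.volumeIoiPow, lintegral_withDensity_eq_lintegral_mul _ (by fun_prop)]
  · rw [← lintegral_subtype_comap measurableSet_Ioi
      (fun r : ℝ => ENNReal.ofReal (r ^ (n - 1)) * f (r • (e : Rn n)))]
    refine lintegral_congr fun r => ?_
    rw [Pi.mul_apply, finrank_euclideanSpace, Fintype.card_fin]
    rfl
  · exact hm.comp measurable_prodMk_left

/-- Two bounded sets separated by the unit sphere are exchanged, up to a definite fraction, by
some reflection whose half-space contains the origin. -/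
theorem exists_reflection_overlap {n : ℕ} (hn : 0 < n) (L : ℝ) :
    ∃ c : ℝ≥0∞, c ≠ 0 ∧ ∀ A A' : Set (Rn n), MeasurableSet A → MeasurableSet A' →
      A ⊆ ball 0 1 → A' ⊆ ball 0 L → Disjoint A' (ball 0 1) →
      ∃ (e : Rn n) (t : ℝ), ‖e‖ = 1 ∧ 0 ≤ t ∧
        c * (volume A * volume A') ≤ volume (A ∩ hyperplaneReflection e t ⁻¹' A') := by
  have : Nonempty (Fin n) := ⟨⟨0, hn⟩⟩
  set K : ℝ≥0∞ := ENNReal.ofReal ((1 + L) ^ (n - 1)) * 2 *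
    (ENNReal.ofReal (2 * L) * (volume : Measure (Rn n)).toSphere univ) with hK
  have hKt : K ≠ ∞ := by
    simp only [hK]
    finiteness
  refine ⟨(2 * (K + 1))⁻¹, by simp; finiteness, fun A A' hA hA' hA1 hAL hdisj => ?_⟩
  by_contra! hcon
  have hcon' : ∀ (e : Rn n) (t : ℝ), ‖e‖ = 1 → volume (A ∩ hyperplaneReflection e t ⁻¹' A')
      ≤ (2 * (K + 1))⁻¹ * (volume A * volume A') := by
    intro e t he
    rcases le_total 0 t with ht | ht
    · exact (hcon e t he ht).le
    · have := (hcon (-e) (-t) (by simpa) (by linarith)).le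
      rwa [hyperplaneReflection_neg] at this
  have slice : ∀ x ∈ A, ∀ e : sphere (0 : Rn n) 1,
      ∫⁻ r in Ioi (0 : ℝ), ENNReal.ofReal (r ^ (n - 1)) * A'.indicator 1 (x + r • (e : Rn n))
      ≤ ENNReal.ofReal ((1 + L) ^ (n - 1)) * 2 *
        ∫⁻ t in Icc (-L) L, A'.indicator 1 (hyperplaneReflection e t x) := by
    intro x hx e
    have he : ‖(e : Rn n)‖ = 1 := by simp
    have hx1 : ‖x‖ < 1 := by simpa using hA1 hx
    have hxe : |inner ℝ (e : Rn n) x| ≤ ‖x‖ := by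
      simpa [he] using abs_real_inner_le_norm (e : Rn n) x
    set g : ℝ → ℝ≥0∞ := fun r => A'.indicator 1 (x + r • (e : Rn n)) with hg
    have gm : Measurable g := (measurable_one.indicator hA').comp (by fun_prop)
    have hrefl : ∀ t, A'.indicator (1 : Rn n → ℝ≥0∞) (hyperplaneReflection e t x)
        = g (2 * (t - inner ℝ (e : Rn n) x)) := by
      intro t
      simp only [hg, hyperplaneReflection]
      congr 1
      rw [sub_eq_add_neg, ← neg_smul]
      congr 2
      ring
    have scale : ∫⁻ r, g r = 2 * ∫⁻ t, g (2 * (t - inner ℝ (e : Rn n) x)) := by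
      rw [lintegral_sub_right_eq_self (fun t => g (2 * t)),
        ← lintegral_map gm (measurable_const_mul (2 : ℝ))]
      conv_lhs => rw [← Real.smul_map_volume_mul_left (two_ne_zero (α := ℝ)),
        lintegral_smul_measure]
      simp
    have support : ∫⁻ t, g (2 * (t - inner ℝ (e : Rn n) x))
        = ∫⁻ t in Icc (-L) L, A'.indicator 1 (hyperplaneReflection e t x) := by
      rw [← lintegral_indicator measurableSet_Icc]
      refine lintegral_congr fun t => ?_
      rw [← hrefl]
      by_cases ht : t ∈ Icc (-L) L
      · rw [indicator_of_mem ht]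
      · rw [indicator_of_notMem ht, indicator_of_notMem]
        intro hmem
        apply ht
        have h1 := hAL hmem
        have h2 : hyperplaneReflection e t x ∉ ball (0 : Rn n) 1 := fun h =>
          disjoint_left.1 hdisj hmem h
        have h3 := abs_real_inner_le_norm (e : Rn n) (hyperplaneReflection e t x)
        rw [inner_hyperplaneReflection he, he, one_mul] at h3
        simp only [mem_ball, dist_zero_right, not_lt] at h1 h2
        rw [abs_le] at h3 hxe
        constructor <;> linarith
    rw [mul_assoc, ← support, ← scale, ← lintegral_const_mul _ gm]
    refine (setLIntegral_mono (gm.const_mul _) fun r hr => ?_).trans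
      (setLIntegral_le_lintegral _ _)
    by_cases hmem : x + r • (e : Rn n) ∈ A'
    · refine mul_le_mul_left ?_ _
      refine ENNReal.ofReal_le_ofReal (pow_le_pow_left₀ (le_of_lt hr) ?_ _)
      have h1 : ‖x + r • (e : Rn n)‖ < L := by simpa using hAL hmem
      have h2 : ‖r • (e : Rn n)‖ = r := by
        rw [norm_smul, he, mul_one, Real.norm_eq_abs, abs_of_pos hr]
      have h3 := norm_sub_le (x + r • (e : Rn n)) x
      rw [add_sub_cancel_left, h2] at h3
      linarith
    · simp [hg, indicator_of_notMem hmem]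
  have total : ∀ x ∈ A, volume A' ≤ ENNReal.ofReal ((1 + L) ^ (n - 1)) * 2 *
      ∫⁻ e : sphere (0 : Rn n) 1, ∫⁻ t in Icc (-L) L,
        A'.indicator 1 (hyperplaneReflection e t x) ∂volume
        ∂(volume : Measure (Rn n)).toSphere := by
    intro x hx
    have m : Measurable (A'.indicator (1 : Rn n → ℝ≥0∞)) := measurable_one.indicator hA'
    calc volume A' = ∫⁻ y, A'.indicator (1 : Rn n → ℝ≥0∞) y := (lintegral_indicator_one hA').symm
      _ = ∫⁻ y, A'.indicator (1 : Rn n → ℝ≥0∞) (x + y) := (lintegral_add_left_eq_self _ x).symm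
      _ = _ := lintegral_polar hn (m.comp (measurable_const_add x))
      _ ≤ ∫⁻ e : sphere (0 : Rn n) 1, ENNReal.ofReal ((1 + L) ^ (n - 1)) * 2 *
            ∫⁻ t in Icc (-L) L, A'.indicator 1 (hyperplaneReflection e t x) ∂volume
          ∂(volume : Measure (Rn n)).toSphere := lintegral_mono fun e => slice x hx e
      _ = _ := lintegral_const_mul' _ _ (by finiteness)
  have fub : ∫⁻ x in A, ∫⁻ e : sphere (0 : Rn n) 1, ∫⁻ t in Icc (-L) L,
        A'.indicator 1 (hyperplaneReflection e t x) ∂volume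
        ∂(volume : Measure (Rn n)).toSphere
      = ∫⁻ e : sphere (0 : Rn n) 1, ∫⁻ t in Icc (-L) L,
        volume (A ∩ hyperplaneReflection e t ⁻¹' A') ∂volume
        ∂(volume : Measure (Rn n)).toSphere := by
    have m : Measurable (A'.indicator (1 : Rn n → ℝ≥0∞)) := measurable_one.indicator hA'
    have m3 : Measurable fun p : (Rn n × sphere (0 : Rn n) 1) × ℝ =>
        A'.indicator (1 : Rn n → ℝ≥0∞) (hyperplaneReflection p.1.2 p.2 p.1.1) := by
      refine m.comp (continuous_hyperplaneReflection.comp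
        (f := fun p : (Rn n × sphere (0 : Rn n) 1) × ℝ => ((p.1.2 : Rn n), p.2, p.1.1))
          ?_).measurable
      fun_prop
    rw [lintegral_lintegral_swap (m3.lintegral_prod_right'
        (ν := volume.restrict (Icc (-L) L))).aemeasurable]
    refine lintegral_congr fun e => ?_
    have m2 : Measurable fun p : Rn n × ℝ =>
        A'.indicator (1 : Rn n → ℝ≥0∞) (hyperplaneReflection e p.2 p.1) := by
      have hf : Measurable fun p : Rn n × ℝ => ((p.1, e), p.2) := by fun_prop
      exact m3.comp hf
    rw [lintegral_lintegral_swap m2.aemeasurable]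
    refine lintegral_congr fun t => ?_
    have hme : MeasurableSet (hyperplaneReflection (e : Rn n) t ⁻¹' A') :=
      (isHalfSpaceReflection_hyperplaneReflection (by simp)
        t).measurePreserving.measurable hA'
    rw [inter_comm, ← Measure.restrict_apply hme, ← lintegral_indicator_one hme]
    rfl
  have hle : volume A * volume A' ≤ K * ((2 * (K + 1))⁻¹ * (volume A * volume A')) := by
    calc volume A * volume A' = ∫⁻ x in A, volume A' := by
          rw [setLIntegral_const, mul_comm]
      _ ≤ ∫⁻ x in A, ENNReal.ofReal ((1 + L) ^ (n - 1)) * 2 *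
          ∫⁻ e : sphere (0 : Rn n) 1, ∫⁻ t in Icc (-L) L,
            A'.indicator 1 (hyperplaneReflection e t x) ∂volume
            ∂(volume : Measure (Rn n)).toSphere := setLIntegral_mono' hA total
      _ = ENNReal.ofReal ((1 + L) ^ (n - 1)) * 2 *
          ∫⁻ e : sphere (0 : Rn n) 1, ∫⁻ t in Icc (-L) L,
            volume (A ∩ hyperplaneReflection e t ⁻¹' A') ∂volume
            ∂(volume : Measure (Rn n)).toSphere := by
          rw [lintegral_const_mul' _ _ (by finiteness), fub]
      _ ≤ ENNReal.ofReal ((1 + L) ^ (n - 1)) * 2 *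
          ∫⁻ e : sphere (0 : Rn n) 1, ∫⁻ t in Icc (-L) L,
            (2 * (K + 1))⁻¹ * (volume A * volume A') ∂volume
            ∂(volume : Measure (Rn n)).toSphere := by
          gcongr with e t
          exact hcon' e t (by simp)
      _ = K * ((2 * (K + 1))⁻¹ * (volume A * volume A')) := by
          simp only [lintegral_const, Measure.restrict_apply_univ, Real.volume_Icc, hK]
          ring_nf
  have hfin : volume A * volume A' ≠ ∞ := ENNReal.mul_ne_top
    ((measure_mono hA1).trans_lt measure_ball_lt_top).ne
    ((measure_mono hAL).trans_lt measure_ball_lt_top).ne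
  have hhalf : K * (2 * (K + 1))⁻¹ ≤ 2⁻¹ := by
    rw [ENNReal.mul_inv (by simp) (by simp), mul_left_comm]
    refine mul_le_of_le_one_right (by simp) ?_
    rw [← div_eq_mul_inv]
    exact ENNReal.div_le_of_le_mul (by simp)
  have hzero : volume A * volume A' = 0 := by
    by_contra h0
    have h1 : volume A * volume A' ≤ 2⁻¹ * (volume A * volume A') :=
      hle.trans (by rw [← mul_assoc]; gcongr)
    have h2 := ENNReal.half_lt_self h0 hfin
    rw [div_eq_mul_inv, mul_comm] at h2
    exact absurd h1 (not_le.2 h2)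
  obtain ⟨e, he⟩ := exists_norm_eq (Rn n) zero_le_one
  have := hcon e 0 he le_rfl
  simp [hzero] at this

theorem polarization_subset_ball {n : ℕ} {e : Rn n} (he : ‖e‖ = 1) {t : ℝ} (ht : 0 ≤ t) {L : ℝ}
    {E : Set (Rn n)} (hE : E ⊆ ball 0 L) :
    polarization (hyperplaneReflection e t) {x | inner ℝ e x ≤ t} E ⊆ ball 0 L := by
  rintro x (⟨hx, h | h⟩ | ⟨h, -⟩)
  · exact hE h
  · have h1 := hE h
    simp only [mem_ball, dist_zero_right] at h1 ⊢
    exact (norm_le_norm_hyperplaneReflection he ht hx).trans_lt h1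
  · exact hE h

theorem volume_diff_le_volume_diff {n : ℕ} {E B : Set (Rn n)} (hE : MeasurableSet E)
    (hB : MeasurableSet B) (hfin : volume B ≠ ∞) (hvol : volume E ≤ volume B) :
    volume (E \ B) ≤ volume (B \ E) := by
  rw [← measure_inter_add_sdiff E hB, ← measure_inter_add_sdiff B hE, inter_comm] at hvol
  exact (ENNReal.add_le_add_iff_left (measure_ne_top_of_subset inter_subset_left hfin)).1 hvol

theorem interaction_mono {n : ℕ} {k l : ℝ → ℝ≥0∞} (hkl : k ≤ l) {A B A' B' : Set (Rn n)}
    (hA : A ⊆ A') (hB : B ⊆ B') : interaction k A B ≤ interaction l A' B' :=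
  (lintegral_mono fun _ => hkl _).trans (lintegral_mono_set (prod_mono hA hB))

theorem interaction_le_mul {n : ℕ} {k : ℝ → ℝ≥0∞} {M : ℝ≥0∞} (hM : ∀ r, k r ≤ M)
    (A B : Set (Rn n)) : interaction k A B ≤ M * (volume A * volume B) := by
  calc interaction k A B ≤ ∫⁻ _ in A ×ˢ B, M ∂(volume.prod volume) := lintegral_mono fun _ => hM _
    _ = _ := by rw [setLIntegral_const, Measure.prod_prod]

theorem interaction_self_le_add {n : ℕ} {k : ℝ → ℝ≥0∞} {M : ℝ≥0∞} (hM : ∀ r, k r ≤ M)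
    (F B : Set (Rn n)) :
    interaction k F F ≤ interaction k B B + 2 * M * volume F * volume (F \ B) := by
  have hsub : F ×ˢ F ⊆ B ×ˢ B ∪ ((F \ B) ×ˢ F ∪ F ×ˢ (F \ B)) := by
    rintro ⟨x, y⟩ ⟨hx, hy⟩
    simp only [mem_union, mem_prod, Set.mem_sdiff] at hx hy ⊢
    tauto
  calc interaction k F F
      ≤ ∫⁻ p in B ×ˢ B ∪ ((F \ B) ×ˢ F ∪ F ×ˢ (F \ B)), k ‖p.1 - p.2‖ ∂(volume.prod volume) :=
        lintegral_mono_set hsub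
    _ ≤ interaction k B B + (interaction k (F \ B) F + interaction k F (F \ B)) :=
        (lintegral_union_le _ _ _).trans (by gcongr; exacts [le_rfl, lintegral_union_le _ _ _])
    _ ≤ interaction k B B +
        (M * (volume (F \ B) * volume F) + M * (volume F * volume (F \ B))) := by
        gcongr <;> exact interaction_le_mul hM _ _
    _ = _ := by ring

/-- Riesz's rearrangement inequality for bounded sets and bounded kernels. -/
theorem interaction_self_le_ball_of_subset_ball {n : ℕ} (hn : 0 < n) {k : ℝ → ℝ≥0∞}
    (hk : Antitone k) {M : ℝ≥0∞} (hMt : M ≠ ∞) (hM : ∀ r, k r ≤ M) {L : ℝ} {E : Set (Rn n)}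
    (hE : MeasurableSet E) (hEL : E ⊆ ball 0 L) (hvol : volume E ≤ volume (ball (0 : Rn n) 1)) :
    interaction k E E ≤ interaction k (ball (0 : Rn n) 1) (ball 0 1) := by
  obtain ⟨c, hc0, hc⟩ := exists_reflection_overlap hn L
  set B : Set (Rn n) := ball 0 1 with hB
  have hBm : MeasurableSet B := measurableSet_ball
  have hBt : volume B ≠ ∞ := measure_ball_lt_top.ne
  set good : Set (Set (Rn n)) := {F | MeasurableSet F ∧ F ⊆ ball 0 L ∧ volume F = volume E ∧
    interaction k E E ≤ interaction k F F} with hgood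
  have step : ∀ F ∈ good, ∃ F' ∈ good,
      volume (F' \ B) + c * (volume (F \ B) * volume (F \ B)) ≤ volume (F \ B) := by
    rintro F ⟨hF, hFL, hFv, hFJ⟩
    have hFB : volume F ≤ volume B := hFv.trans_le hvol
    have hFt : volume F ≠ ∞ := ne_top_of_le_ne_top hBt hFB
    obtain ⟨e, t, he, ht, het⟩ := hc (B \ F) (F \ B) (hBm.diff hF) (hF.diff hBm) sdiff_subset
      (sdiff_subset.trans hFL) disjoint_sdiff_left
    have hσ := isHalfSpaceReflection_hyperplaneReflection he t
    refine ⟨polarization (hyperplaneReflection e t) {x | inner ℝ e x ≤ t} F,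
      ⟨hσ.measurableSet_polarization hF, polarization_subset_ball he ht hFL,
        (hσ.volume_polarization hF).trans hFv, hFJ.trans (hσ.interaction_le hF hk)⟩, ?_⟩
    have h1 := hσ.volume_inter_add_le hF hBm fun x hx hxB => by
      simp only [hB, mem_ball, dist_zero_right] at hxB ⊢
      exact (norm_le_norm_hyperplaneReflection he ht hx).trans_lt hxB
    have h2 := hσ.volume_polarization hF
    set F' := polarization (hyperplaneReflection e t) {x | inner ℝ e x ≤ t} F
    rw [← measure_inter_add_sdiff F' hBm, ← measure_inter_add_sdiff F hBm] at h2
    have h3 : c * (volume (F \ B) * volume (F \ B)) ≤ c * (volume (B \ F) * volume (F \ B)) := by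
      exact mul_le_mul_right (mul_le_mul_left (volume_diff_le_volume_diff hF hBm hBt hFB) _) _
    refine (ENNReal.add_le_add_iff_left (measure_ne_top_of_subset
        (inter_subset_left (t := B)) hFt)).1 ?_
    calc volume (F ∩ B) + (volume (F' \ B) + c * (volume (F \ B) * volume (F \ B)))
        = (volume (F ∩ B) + c * (volume (F \ B) * volume (F \ B))) + volume (F' \ B) := by ring
      _ ≤ volume (F' ∩ B) + volume (F' \ B) := by
        gcongr
        exact le_trans (by gcongr; exact h3.trans het) h1
      _ = _ := h2
  set a : ℝ≥0∞ := ⨅ F ∈ good, volume (F \ B) with ha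
  have exists_lt : ∀ b, a < b → ∃ F ∈ good, volume (F \ B) < b := fun b hb => by
    simpa only [ha, iInf_lt_iff, exists_prop] using hb
  have hEgood : E ∈ good := ⟨hE, hEL, rfl, le_rfl⟩
  have hat : a ≠ ∞ := ne_top_of_le_ne_top
    (measure_ne_top_of_subset sdiff_subset (ne_top_of_le_ne_top hBt hvol)) (iInf₂_le E hEgood)
  have ha0 : a = 0 := by
    by_contra h0
    have h1 : a < a + c * (a * a) := ENNReal.lt_add_right hat (by simp [h0, hc0])
    obtain ⟨F, hF, hFa⟩ := exists_lt _ h1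
    obtain ⟨F', hF', hFF'⟩ := step F hF
    have h2 : a ≤ volume (F' \ B) := iInf₂_le F' hF'
    have h3 : a ≤ volume (F \ B) := iInf₂_le F hF
    refine absurd (hFF'.trans_lt hFa) (not_lt.2 ?_)
    gcongr
  refine ENNReal.le_of_forall_pos_le_add fun ε hε _ => ?_
  set C : ℝ≥0∞ := 2 * M * volume E + 1 with hC
  have hCt : C ≠ ∞ := by
    have := ne_top_of_le_ne_top hBt hvol
    simp only [hC]
    finiteness
  have h1 : a < ε / C := by
    rw [ha0]
    exact ENNReal.div_pos (by simpa using hε.ne') hCt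
  obtain ⟨F, hF, hFa⟩ := exists_lt _ h1
  calc interaction k E E ≤ interaction k F F := hF.2.2.2
    _ ≤ interaction k B B + 2 * M * volume F * volume (F \ B) := interaction_self_le_add hM F B
    _ ≤ interaction k B B + C * (ε / C) := by
      rw [hF.2.2.1]
      gcongr
      exact le_self_add
    _ ≤ interaction k B B + ε := by
      gcongr
      exact ENNReal.mul_div_le

/-- Riesz's rearrangement inequality for bounded kernels. -/
theorem interaction_self_le_ball {n : ℕ} (hn : 0 < n) {k : ℝ → ℝ≥0∞}
    (hk : Antitone k) {M : ℝ≥0∞} (hMt : M ≠ ∞) (hM : ∀ r, k r ≤ M) {E : Set (Rn n)}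
    (hE : MeasurableSet E) (hvol : volume E ≤ volume (ball (0 : Rn n) 1)) :
    interaction k E E ≤ interaction k (ball (0 : Rn n) 1) (ball 0 1) := by
  have hmono : Monotone fun L : ℕ => (E ∩ ball (0 : Rn n) L) ×ˢ (E ∩ ball (0 : Rn n) L) := by
    intro L L' hL
    have : ball (0 : Rn n) L ⊆ ball 0 L' := ball_subset_ball (by exact_mod_cast hL)
    exact prod_mono (inter_subset_inter_right _ this) (inter_subset_inter_right _ this)
  have hU : E ×ˢ E = ⋃ L : ℕ, (E ∩ ball (0 : Rn n) L) ×ˢ (E ∩ ball (0 : Rn n) L) := by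
    ext ⟨x, y⟩
    simp only [mem_prod, mem_iUnion, mem_inter_iff, mem_ball, dist_zero_right]
    refine ⟨fun h => ?_, fun ⟨L, h⟩ => ⟨h.1.1, h.2.1⟩⟩
    obtain ⟨L, hL⟩ := exists_nat_gt (max ‖x‖ ‖y‖)
    exact ⟨L, ⟨h.1, (le_max_left _ _).trans_lt hL⟩, h.2, (le_max_right _ _).trans_lt hL⟩
  rw [interaction, hU, setLIntegral_iUnion_of_directed _ hmono.directed_le]
  exact iSup_le fun L => interaction_self_le_ball_of_subset_ball hn hk hMt hM
    (hE.inter measurableSet_ball) inter_subset_right ((measure_mono inter_subset_left).trans hvol)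

theorem interaction_add_interaction_compl {n : ℕ} {k : ℝ → ℝ≥0∞} (hk : Measurable k)
    {E : Set (Rn n)} (hE : MeasurableSet E) :
    interaction k E E + interaction k E Eᶜ = (∫⁻ z : Rn n, k ‖z‖) * volume E := by
  have h1 : interaction k E E + interaction k E Eᶜ = interaction k E univ := by
    rw [interaction, interaction, interaction, ← lintegral_union (hE.prod hE.compl), ← prod_union,
      union_compl_self]
    exact Set.disjoint_prod.2 (Or.inr disjoint_compl_right)
  rw [h1, interaction_eq_iterated hk, ← setLIntegral_const]
  refine lintegral_congr fun x => ?_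
  rw [Measure.restrict_univ]
  exact lintegral_sub_left_eq_self (fun z => k ‖z‖) x

theorem interaction_self_ne_top {n : ℕ} {k : ℝ → ℝ≥0∞} {M : ℝ≥0∞} (hMt : M ≠ ∞)
    (hM : ∀ r, k r ≤ M) {E : Set (Rn n)} (hE : volume E ≠ ∞) : interaction k E E ≠ ∞ :=
  ne_top_of_le_ne_top (by finiteness) (interaction_le_mul hM E E)

/-- The isoperimetric inequality for nonlocal perimeters with a radially decreasing kernel. -/
theorem interaction_ball_compl_le {n : ℕ} (hn : 0 < n) {k : ℝ → ℝ≥0∞} (hk : Antitone k)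
    {E : Set (Rn n)} (hE : MeasurableSet E)
    (hvol : volume E = volume (ball (0 : Rn n) 1)) :
    interaction k (ball (0 : Rn n) 1) (ball 0 1)ᶜ ≤ interaction k E Eᶜ := by
  have hsup : k = fun r => ⨆ N : ℕ, min (k r) N := by
    ext1 r
    rw [← inf_iSup_eq, ENNReal.iSup_natCast, inf_top_eq]
  have hanti : ∀ N : ℕ, Antitone fun r => min (k r) (N : ℝ≥0∞) := fun N r r' h =>
    min_le_min_right _ (hk h)
  conv_lhs => rw [hsup, interaction]
  rw [lintegral_iSup (fun N => measurable_kernel (hanti N).measurable)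
    (fun N N' h p => min_le_min_left _ (by exact_mod_cast h))]
  refine iSup_le fun N => ?_
  refine le_trans ?_ (interaction_mono (k := fun r => min (k r) (N : ℝ≥0∞))
    (fun r => min_le_left _ _) (subset_refl E) (subset_refl Eᶜ))
  have h1 := interaction_add_interaction_compl (hanti N).measurable hE
  have h2 := interaction_add_interaction_compl (hanti N).measurable
    (measurableSet_ball (x := (0 : Rn n)) (ε := 1))
  have h3 := interaction_self_le_ball hn (hanti N) (ENNReal.natCast_ne_top N)
    (fun r => min_le_right _ _) hE hvol.le
  have h4 := interaction_self_ne_top (ENNReal.natCast_ne_top N)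
    (fun r => min_le_right (k r) _) (measure_ball_lt_top (x := (0 : Rn n)) (r := 1)).ne
  refine (ENNReal.add_le_add_iff_left h4).1 ?_
  calc _ = _ := h2
    _ = _ := by rw [← hvol, ← h1]
    _ ≤ _ := by gcongr

/-- The fractional kernel `r ^ (-p)` minus a small multiple of the truncated parabola
`(100 - r ^ 2)₊`. -/
def reducedKernel (p r : ℝ) : ℝ := r ^ (-p) - 10 ^ (-p - 2) * max (100 - r ^ 2) 0

theorem reducedKernel_le {p : ℝ} (hp : 2 ≤ p) {r r' : ℝ} (hr : 0 < r) (h : r ≤ r') :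
    reducedKernel p r' ≤ reducedKernel p r := by
  have h10 : (0 : ℝ) < 10 ^ (-p - 2) := by positivity
  have inner : ∀ {r r' : ℝ}, 0 < r → r ≤ r' → r' ≤ 10 →
      reducedKernel p r' ≤ reducedKernel p r := by
    intro r r' hr h h'
    have hr' : 0 < r' := hr.trans_le h
    have e1 : r ^ (-p) = r' ^ (-p) * (r' / r) ^ p := by
      rw [Real.div_rpow hr'.le hr.le, Real.rpow_neg hr'.le, Real.rpow_neg hr.le]
      field_simp
    have e2 : (r' / r) ^ (2 : ℕ) ≤ (r' / r) ^ p := by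
      rw [← Real.rpow_natCast]
      exact Real.rpow_le_rpow_of_exponent_le ((one_le_div hr).2 h) (by exact_mod_cast hp)
    have e3 : (10 : ℝ) ^ (-p) ≤ r' ^ (-p) := Real.rpow_le_rpow_of_nonpos hr' h' (by linarith)
    have e4 : (10 : ℝ) ^ (-p - 2) = 10 ^ (-p) / 100 := by
      rw [Real.rpow_sub (by norm_num)]
      norm_num
    have e5 : (r' ^ 2 - r ^ 2) / 100 ≤ (r' / r) ^ 2 - 1 := by
      rw [div_pow, div_sub_one (by positivity)]
      exact div_le_div_of_nonneg_left (by nlinarith) (by positivity) (by nlinarith)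
    have e6 : (0 : ℝ) ≤ r' ^ 2 - r ^ 2 := by nlinarith
    have e7 : 10 ^ (-p) * ((r' ^ 2 - r ^ 2) / 100) ≤ r' ^ (-p) * ((r' / r) ^ p - 1) := by
      have : (0 : ℝ) ≤ r' ^ (-p) := by positivity
      exact mul_le_mul e3 (e5.trans (by linarith)) (by positivity) this
    rw [reducedKernel, reducedKernel, max_eq_left (by nlinarith), max_eq_left (by nlinarith),
      e4, e1]
    linarith
  have outer : ∀ {r r' : ℝ}, 10 ≤ r → r ≤ r' → reducedKernel p r' ≤ reducedKernel p r := by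
    intro r r' hr h
    rw [reducedKernel, reducedKernel, max_eq_right (by nlinarith), max_eq_right (by nlinarith)]
    simpa using Real.rpow_le_rpow_of_nonpos (by linarith) h (by linarith : -p ≤ 0)
  rcases le_total r' 10 with h1 | h1
  · exact inner hr h h1
  rcases le_total r 10 with h2 | h2
  · exact (outer le_rfl h1).trans (inner hr h2 le_rfl)
  · exact outer h2 h

theorem reducedKernel_nonneg {p : ℝ} (hp : 2 ≤ p) {r : ℝ} (hr : 0 < r) : 0 ≤ reducedKernel p r := by
  refine le_trans ?_ (reducedKernel_le hp hr (le_max_left r 10))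
  have : (10 : ℝ) ≤ max r 10 := le_max_right _ _
  rw [reducedKernel, max_eq_right (a := 100 - _) (by nlinarith)]
  simp only [mul_zero, sub_zero]
  positivity

theorem ofReal_max_zero (x : ℝ) : ENNReal.ofReal (max x 0) = ENNReal.ofReal x := by
  simp [ENNReal.ofReal, Real.toNNReal]

/-- The truncated second moment `∬_{E × E} min(|x - y|², 100) dx dy`. -/
def truncMoment {n : ℕ} (E : Set (Rn n)) : ℝ≥0∞ :=
  interaction (fun r => ENNReal.ofReal (min (r ^ 2) 100)) E E

theorem fracPer_eq_add {n : ℕ} (hn : 2 ≤ n) {s : ℝ} (hs : 0 < s) {E : Set (Rn n)}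
    (hE : MeasurableSet E) :
    fracPer n s E =
      interaction (fun r => if r ≤ 0 then ∞ else ENNReal.ofReal (reducedKernel (n + s) r)) E Eᶜ +
      ENNReal.ofReal (10 ^ (-((n : ℝ) + s) - 2)) *
        interaction (fun r => ENNReal.ofReal (100 - r ^ 2)) E Eᶜ := by
  have hp : (2 : ℝ) ≤ n + s := by
    have : (2 : ℝ) ≤ n := by exact_mod_cast hn
    linarith
  have m1 : Measurable fun r : ℝ => ENNReal.ofReal (100 - r ^ 2) := by fun_prop
  have m2 : Measurable fun r : ℝ => ENNReal.ofReal (r ^ (-((n : ℝ) + s))) := by fun_prop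
  rw [fracPer, ← interaction_eq_iterated m2, interaction, interaction, interaction,
    ← lintegral_const_mul _ (measurable_kernel m1),
    ← lintegral_add_right _ ((measurable_kernel m1).const_mul _)]
  refine setLIntegral_congr_fun (hE.prod hE.compl) ?_
  rintro ⟨x, y⟩ ⟨hx, hy⟩
  have hxy : 0 < ‖x - y‖ := by
    rw [norm_pos_iff, sub_ne_zero]
    rintro rfl
    exact hy hx
  have h1 := reducedKernel_nonneg hp hxy
  simp only [if_neg (not_le.2 hxy)]
  rw [← ofReal_max_zero (100 - _), ← ENNReal.ofReal_mul (by positivity),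
    ← ENNReal.ofReal_add h1 (by positivity), reducedKernel]
  ring_nf

theorem interaction_parabola_add_truncMoment {n : ℕ} (E : Set (Rn n)) :
    interaction (fun r => ENNReal.ofReal (100 - r ^ 2)) E E + truncMoment E
      = 100 * (volume E * volume E) := by
  have m1 : Measurable fun r : ℝ => ENNReal.ofReal (100 - r ^ 2) := by fun_prop
  rw [truncMoment, interaction, interaction, ← lintegral_add_left (measurable_kernel m1),
    ← Measure.prod_prod, ← setLIntegral_const]
  refine lintegral_congr fun p => ?_
  rw [← ofReal_max_zero (100 - _), ← ENNReal.ofReal_add (by positivity) (by positivity)]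
  rcases le_total (‖p.1 - p.2‖ ^ 2) 100 with h | h
  · rw [min_eq_left h, max_eq_left (by linarith)]
    simp
  · rw [min_eq_right h, max_eq_right (by linarith)]
    simp

/-- The fractional isoperimetric deficit controls the deficit of the truncated second moment. -/
theorem fracPer_ball_add_le {n : ℕ} (hn : 2 ≤ n) {s : ℝ} (hs : 0 < s) {E : Set (Rn n)}
    (hE : MeasurableSet E) (hvol : volume E = volume (ball (0 : Rn n) 1)) :
    fracPer n s (ball (0 : Rn n) 1) + ENNReal.ofReal (10 ^ (-((n : ℝ) + s) - 2)) * truncMoment E ≤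
      fracPer n s E + ENNReal.ofReal (10 ^ (-((n : ℝ) + s) - 2)) *
        truncMoment (ball (0 : Rn n) 1) := by
  have hp : (2 : ℝ) ≤ n + s := by
    have : (2 : ℝ) ≤ n := by exact_mod_cast hn
    linarith
  have hB : MeasurableSet (ball (0 : Rn n) 1) := measurableSet_ball
  have hBt : volume (ball (0 : Rn n) 1) ≠ ∞ := measure_ball_lt_top.ne
  have m1 : Measurable fun r : ℝ => ENNReal.ofReal (100 - r ^ 2) := by fun_prop
  have hmax : ∀ r : ℝ, ENNReal.ofReal (100 - r ^ 2) ≤ 100 := fun r => by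
    rw [← ENNReal.ofReal_ofNat]
    exact ENNReal.ofReal_le_ofReal (by nlinarith)
  have hanti : Antitone fun r : ℝ =>
      if r ≤ 0 then ∞ else ENNReal.ofReal (reducedKernel (n + s) r) := by
    intro r r' h
    by_cases hr : r ≤ 0
    · simp [hr]
    · have hr' : ¬ r' ≤ 0 := fun h' => hr (h.trans h')
      simp only [if_neg hr, if_neg hr']
      exact ENNReal.ofReal_le_ofReal (reducedKernel_le hp (not_le.1 hr) h)
  have hrest := interaction_ball_compl_le (by omega) hanti hE hvol
  have c1 := interaction_add_interaction_compl m1 hE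
  have c2 := interaction_add_interaction_compl m1 hB
  have d1 := interaction_parabola_add_truncMoment E
  have d2 := interaction_parabola_add_truncMoment (ball (0 : Rn n) 1)
  rw [hvol] at c1 d1
  rw [← c2] at c1
  rw [← d2] at d1
  have t1 := interaction_self_ne_top (by simp) hmax hBt
  have t2 : interaction (fun r => ENNReal.ofReal (100 - r ^ 2)) (ball (0 : Rn n) 1)
      (ball (0 : Rn n) 1)ᶜ ≠ ∞ := by
    refine ne_top_of_le_ne_top ?_ (le_add_self.trans c2.le)
    refine ENNReal.mul_ne_top (ne_top_of_le_ne_top (b := 100 * volume (ball (0 : Rn n) 10))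
      (ENNReal.mul_ne_top (by simp) measure_ball_lt_top.ne) ?_) hBt
    rw [← setLIntegral_const, ← lintegral_indicator measurableSet_ball]
    refine lintegral_mono fun z => ?_
    by_cases hz : z ∈ ball (0 : Rn n) 10
    · rw [indicator_of_mem hz]
      exact hmax _
    · rw [indicator_of_notMem hz, nonpos_iff_eq_zero, ENNReal.ofReal_eq_zero]
      simp only [mem_ball, dist_zero_right, not_lt] at hz
      nlinarith
  rw [fracPer_eq_add hn hs hE, fracPer_eq_add hn hs hB]
  have hc := ENNReal.ofReal_ne_top (r := 10 ^ (-((n : ℝ) + s) - 2))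
  generalize interaction (fun r => ENNReal.ofReal (100 - r ^ 2)) (ball (0 : Rn n) 1)
      (ball (0 : Rn n) 1)ᶜ = PB at *
  generalize interaction (fun r => ENNReal.ofReal (100 - r ^ 2)) (ball (0 : Rn n) 1)
      (ball (0 : Rn n) 1) = JB at *
  generalize interaction (fun r => ENNReal.ofReal (100 - r ^ 2)) E Eᶜ = PE at *
  generalize interaction (fun r => ENNReal.ofReal (100 - r ^ 2)) E E = JE at *
  generalize ENNReal.ofReal (10 ^ (-((n : ℝ) + s) - 2)) = c at *
  refine (ENNReal.add_le_add_iff_left (a := c * (JE + PE + JB)) (by rw [c1]; finiteness)).1 ?_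
  generalize interaction _ (ball (0 : Rn n) 1) (ball (0 : Rn n) 1)ᶜ = KB at *
  calc _ = (KB + c * (PB + JB + PE)) + c * (JE + truncMoment E) := by ring
    _ ≤ (interaction _ E Eᶜ + c * (PB + JB + PE)) + c * (JE + truncMoment E) := by gcongr
    _ = interaction _ E Eᶜ + c * (PE + (JB + PB) + (JB + truncMoment (ball (0 : Rn n) 1))) := by
      rw [d1]; ring
    _ = _ := by rw [← c1]; ring

theorem volume_ball_diff_ball_le {n : ℕ} (hn : 0 < n) {a b : ℝ} (ha : 0 ≤ a) (hab : a ≤ b)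
    (hb : b ≤ 2) : volume (ball (0 : Rn n) b \ ball 0 a) ≤
      ENNReal.ofReal (n * 2 ^ n * (b - a)) * volume (ball (0 : Rn n) 1) := by
  have : Nonempty (Fin n) := ⟨⟨0, hn⟩⟩
  have pow_sub : ∀ m : ℕ, b ^ m - a ^ m ≤ m * 2 ^ m * (b - a) := by
    intro m
    induction m with
    | zero => simp
    | succ m ih =>
      have h1 : a ^ m ≤ 2 ^ m := pow_le_pow_left₀ ha (hab.trans hb) m
      have h2 : a ^ m ≤ b ^ m := pow_le_pow_left₀ ha hab m
      have h3 : (0 : ℝ) ≤ 2 ^ m * (b - a) := mul_nonneg (by positivity) (by linarith)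
      calc b ^ (m + 1) - a ^ (m + 1) = b * (b ^ m - a ^ m) + a ^ m * (b - a) := by ring
        _ ≤ 2 * (m * 2 ^ m * (b - a)) + 2 ^ m * (b - a) := by
          have := mul_le_mul hb ih (by linarith) (by norm_num)
          have := mul_le_mul_of_nonneg_right h1 (by linarith : 0 ≤ b - a)
          linarith
        _ ≤ _ := by push_cast [pow_succ]; nlinarith
  rw [measure_sdiff (ball_subset_ball hab) measurableSet_ball.nullMeasurableSet
    measure_ball_lt_top.ne, Measure.addHaar_ball _ _ (ha.trans hab), Measure.addHaar_ball _ _ ha,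
    ← ENNReal.sub_mul (fun _ _ => measure_ball_lt_top.ne), ← ENNReal.ofReal_sub _ (by positivity)]
  gcongr
  simpa using pow_sub n

theorem setLIntegral_ball_rpow_neg_ne_top {n : ℕ} (hn : 0 < n) {q : ℝ} (hq : q < n) :
    ∫⁻ z in ball (0 : Rn n) 1, ENNReal.ofReal (‖z‖ ^ (-q)) ≠ ∞ := by
  have : IntegrableOn (fun z : Rn n => ‖z‖ ^ (-q)) (ball 0 1) := by
    refine integrableOn_ball_of_norm_le_rpow (C := 1) (α := q)
      (by rw [finrank_euclideanSpace, Fintype.card_fin]; omega)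
      (by simpa) ?_ ?_
    · refine .of_forall fun z => ?_
      rw [Real.norm_eq_abs, abs_of_nonneg (by positivity), one_mul]
    · exact (by fun_prop : Measurable fun z : Rn n => ‖z‖ ^ (-q)).aestronglyMeasurable
  exact this.lintegral_lt_top.ne

theorem setLIntegral_compl_ball_rpow_neg_ne_top {n : ℕ} {p : ℝ} (hp : (n : ℝ) < p) :
    ∫⁻ z in (ball (0 : Rn n) 1)ᶜ, ENNReal.ofReal (‖z‖ ^ (-p)) ≠ ∞ := by
  have hp0 : 0 < p := n.cast_nonneg.trans_lt hp
  have hint : Integrable fun z : Rn n => 2 ^ p * (1 + ‖z‖) ^ (-p) :=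
    (integrable_one_add_norm (by simpa using hp)).const_mul _
  refine ne_top_of_le_ne_top hint.lintegral_lt_top.ne
    ((setLIntegral_mono (by fun_prop) fun z hz => ?_).trans (setLIntegral_le_lintegral _ _))
  simp only [mem_compl_iff, mem_ball, dist_zero_right, not_lt] at hz
  refine ENNReal.ofReal_le_ofReal ?_
  rw [Real.rpow_neg (by positivity), Real.rpow_neg (by positivity), ← div_eq_mul_inv,
    ← Real.div_rpow (by norm_num) (by positivity), ← Real.inv_rpow (by positivity)]
  refine Real.rpow_le_rpow (by positivity) ?_ hp0.le
  rw [inv_eq_one_div, div_le_div_iff₀ (by linarith) (by linarith)]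
  linarith

theorem Vs_ball_ne_top {n : ℕ} (hn : 2 ≤ n) {s : ℝ} (hs0 : 0 < s) (hs1 : s < 1) :
    Vs n s (ball 0 1) ≠ ∞ := by
  have hsn : s < n := hs1.trans (by exact_mod_cast hn)
  refine ne_top_of_le_ne_top (ENNReal.add_ne_top.2
    ⟨setLIntegral_ball_rpow_neg_ne_top (by omega) hsn,
      (measure_ball_lt_top (μ := volume) (x := (0 : Rn n)) (r := 1)).ne⟩) (iSup_le fun y => ?_)
  have hle : ∀ x : Rn n, ENNReal.ofReal (‖x - y‖ ^ (-s)) ≤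
      (ball (0 : Rn n) 1).indicator (fun z => ENNReal.ofReal (‖z‖ ^ (-s))) (x - y) + 1 := by
    intro x
    by_cases h : x - y ∈ ball (0 : Rn n) 1
    · rw [indicator_of_mem h]
      exact le_self_add
    · rw [indicator_of_notMem h, zero_add]
      simp only [mem_ball, dist_zero_right, not_lt] at h
      rw [ENNReal.ofReal_le_one]
      exact Real.rpow_le_one_of_one_le_of_nonpos h (by linarith)
  calc rieszAt n s (ball 0 1) y
      ≤ ∫⁻ x in ball 0 1, ((ball (0 : Rn n) 1).indicator
          (fun z => ENNReal.ofReal (‖z‖ ^ (-s))) (x - y) + 1) := lintegral_mono hle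
    _ ≤ (∫⁻ x, (ball (0 : Rn n) 1).indicator (fun z => ENNReal.ofReal (‖z‖ ^ (-s))) (x - y)) +
          volume (ball (0 : Rn n) 1) := by
      rw [lintegral_add_right _ measurable_const, setLIntegral_const, one_mul]
      exact add_le_add (setLIntegral_le_lintegral _ _) le_rfl
    _ = _ := by
      rw [lintegral_sub_right_eq_self (fun x => (ball (0 : Rn n) 1).indicator
        (fun z => ENNReal.ofReal (‖z‖ ^ (-s))) x), lintegral_indicator measurableSet_ball]

theorem fracPer_ball_ne_top {n : ℕ} (hn : 2 ≤ n) {s : ℝ} (hs0 : 0 < s) (hs1 : s < 1) :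
    fracPer n s (ball 0 1) ≠ ∞ := by
  set B : Set (Rn n) := ball 0 1 with hB
  set K : Rn n → ℝ≥0∞ := fun z => ENNReal.ofReal (‖z‖ ^ (-((n : ℝ) + s))) with hK
  have hKm : Measurable K := by fun_prop
  have hBm : MeasurableSet B := measurableSet_ball
  have hBt : volume B ≠ ∞ := measure_ball_lt_top.ne
  have hmove : ∀ h : Rn n, ∫⁻ x in B, Bᶜ.indicator (1 : Rn n → ℝ≥0∞) (x + h) =
      volume ((· + h) ⁻¹' Bᶜ ∩ B) := by
    intro h
    have hm : MeasurableSet ((· + h) ⁻¹' Bᶜ) := (measurable_add_const h) hBm.compl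
    rw [← Measure.restrict_apply hm, ← lintegral_indicator_one hm]
    rfl
  have hper : fracPer n s B = ∫⁻ h, K h * volume ((· + h) ⁻¹' Bᶜ ∩ B) := by
    have e1 : ∀ x : Rn n, ∫⁻ y in Bᶜ, ENNReal.ofReal (‖x - y‖ ^ (-((n : ℝ) + s))) =
        ∫⁻ h, K h * Bᶜ.indicator 1 (x + h) := by
      intro x
      rw [← lintegral_indicator hBm.compl, ← lintegral_add_left_eq_self _ x]
      refine lintegral_congr fun h => ?_
      by_cases hh : x + h ∈ Bᶜ
      · simp [hh, hK]
      · simp [hh]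
    have hm : Measurable fun p : Rn n × Rn n =>
        K p.2 * Bᶜ.indicator (1 : Rn n → ℝ≥0∞) (p.1 + p.2) :=
      (hKm.comp measurable_snd).mul
        ((measurable_one.indicator hBm.compl).comp (measurable_fst.add measurable_snd))
    rw [fracPer, lintegral_congr e1, lintegral_lintegral_swap hm.aemeasurable]
    refine lintegral_congr fun h => ?_
    have hm' : Measurable fun x : Rn n => Bᶜ.indicator (1 : Rn n → ℝ≥0∞) (x + h) :=
      (measurable_one.indicator hBm.compl).comp (measurable_add_const h)
    rw [lintegral_const_mul _ hm', hmove]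
  have hnear : ∀ h ∈ B, K h * volume ((· + h) ⁻¹' Bᶜ ∩ B) ≤
      ENNReal.ofReal (n * 2 ^ n) * volume B * ENNReal.ofReal (‖h‖ ^ (-((n : ℝ) + s - 1))) := by
    intro h hh
    have hh1 : ‖h‖ < 1 := by simpa [hB] using hh
    have hsub : (· + h) ⁻¹' Bᶜ ∩ B ⊆ ball (0 : Rn n) 1 \ ball 0 (1 - ‖h‖) := by
      rintro x ⟨hx, hx'⟩
      refine ⟨hx', fun hx'' => hx ?_⟩
      simp only [hB, mem_ball, dist_zero_right] at hx'' ⊢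
      linarith [norm_add_le x h]
    rcases (norm_nonneg h).eq_or_lt with h0 | h0
    · have : K h = 0 := by
        have : -((n : ℝ) + s) ≠ 0 := by have := n.cast_nonneg (α := ℝ); linarith
        simp only [hK, ← h0, Real.zero_rpow this, ENNReal.ofReal_zero]
      simp [this]
    calc K h * volume ((· + h) ⁻¹' Bᶜ ∩ B)
        ≤ K h * (ENNReal.ofReal (n * 2 ^ n * ‖h‖) * volume B) := by
          gcongr
          refine (measure_mono hsub).trans ((volume_ball_diff_ball_le (by omega) (by linarith)
            (by linarith) (by norm_num)).trans_eq ?_)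
          rw [sub_sub_cancel]
      _ = _ := by
        rw [show -((n : ℝ) + s - 1) = -((n : ℝ) + s) + 1 by ring, Real.rpow_add_one h0.ne',
          ENNReal.ofReal_mul (q := ‖h‖) (by positivity),
          ENNReal.ofReal_mul (q := ‖h‖) (by positivity)]
        ring
  rw [hper, ← lintegral_add_compl _ hBm]
  refine ENNReal.add_ne_top.2 ⟨?_, ?_⟩
  · refine ne_top_of_le_ne_top ?_ (setLIntegral_mono (by fun_prop) hnear)
    rw [lintegral_const_mul _ (by fun_prop)]
    exact ENNReal.mul_ne_top (by finiteness)
      (setLIntegral_ball_rpow_neg_ne_top (by omega) (by linarith))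
  · refine ne_top_of_le_ne_top ?_ (lintegral_mono (g := fun h => K h * volume B) fun h => by
      dsimp only
      gcongr
      exact inter_subset_right)
    rw [lintegral_mul_const _ hKm]
    exact ENNReal.mul_ne_top (setLIntegral_compl_ball_rpow_neg_ne_top (by linarith)) hBt

theorem truncMoment_eq_of_barycenter {n : ℕ} {F : Set (Rn n)} (hF : MeasurableSet F) {x₀ b : Rn n}
    (hF5 : F ⊆ ball x₀ 5) (hb : ∫ y in F, (y - b) = 0) :
    truncMoment F = ENNReal.ofReal (2 * volume.real F * ∫ x in F, ‖x - b‖ ^ 2) := by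
  have hint : ∀ {G : Type} [NormedAddCommGroup G] {f : Rn n → G}, Continuous f →
      IntegrableOn f F := fun hf =>
    (hf.continuousOn.integrableOn_compact (isCompact_closedBall x₀ 5)).mono_set
      (hF5.trans ball_subset_closedBall)
  have hFt : volume F ≠ ∞ := ((measure_mono hF5).trans_lt measure_ball_lt_top).ne
  have : IsFiniteMeasure (volume.restrict F) := ⟨by simpa using hFt.lt_top⟩
  set I := ∫ x in F, ‖x - b‖ ^ 2 with hI
  have hI0 : 0 ≤ I := integral_nonneg fun x => by positivity
  have inner : ∀ x : Rn n, ∫ y in F, ‖x - y‖ ^ 2 = volume.real F * ‖x - b‖ ^ 2 + I := by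
    intro x
    have hexp : ∀ y : Rn n, ‖x - y‖ ^ 2
        = ‖x - b‖ ^ 2 - 2 * inner ℝ (x - b) (y - b) + ‖y - b‖ ^ 2 := fun y => by
      rw [← norm_sub_sq_real, sub_sub_sub_cancel_right]
    rw [integral_congr_ae (.of_forall hexp), integral_add (hint (by fun_prop)) (hint (by fun_prop)),
      integral_sub (hint (by fun_prop)) (hint (by fun_prop)), integral_const_mul,
      integral_inner (hint (by fun_prop)), hb, inner_zero_right, mul_zero,
      sub_zero, integral_const, measureReal_restrict_apply_univ, smul_eq_mul]
  have m1 : Measurable fun r : ℝ => ENNReal.ofReal (min (r ^ 2) 100) := by fun_prop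
  rw [truncMoment, interaction_eq_iterated m1]
  have e1 : ∀ x ∈ F, ∫⁻ y in F, ENNReal.ofReal (min (‖x - y‖ ^ 2) 100)
      = ENNReal.ofReal (volume.real F * ‖x - b‖ ^ 2 + I) := by
    intro x hx
    rw [← inner x, ofReal_integral_eq_lintegral_ofReal (hint (by fun_prop))
      (.of_forall fun y => by positivity)]
    refine setLIntegral_congr_fun hF fun y hy => ?_
    have h1 := mem_ball.1 (hF5 hx)
    have h2 := mem_ball'.1 (hF5 hy)
    have h3 := dist_triangle x x₀ y
    rw [dist_eq_norm x y] at h3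
    rw [min_eq_left (by nlinarith [norm_nonneg (x - y)])]
  rw [setLIntegral_congr_fun hF e1, ← ofReal_integral_eq_lintegral_ofReal (hint (by fun_prop))
    (.of_forall fun x => by positivity), integral_add (hint (by fun_prop)) (hint (by fun_prop)),
    integral_const_mul]
  congr 1
  simp only [integral_const, measureReal_restrict_apply_univ, smul_eq_mul]
  ring

theorem volume_real_unitBall_pos (n : ℕ) : 0 < volume.real (ball (0 : Rn n) 1) :=
  ENNReal.toReal_pos (measure_ball_pos _ _ one_pos).ne' measure_ball_lt_top.ne

theorem volume_real_ball_one {n : ℕ} (b : Rn n) :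
    volume.real (ball b 1) = volume.real (ball (0 : Rn n) 1) := by
  rw [Measure.real, Measure.real, Measure.addHaar_ball_center]

/-- A set of given measure cannot concentrate on the unit sphere centred at `b`. -/
theorem sq_le_setIntegral_abs {n : ℕ} (hn : 0 < n) {S : Set (Rn n)} (hS : MeasurableSet S)
    {b : Rn n} (hint : IntegrableOn (fun x => ‖x - b‖ ^ 2 - 1) S) (hSt : volume S ≠ ∞)
    (hvol : volume.real S ≤ 2 * volume.real (ball (0 : Rn n) 1)) :
    volume.real S ^ 2 / (n * 2 ^ (n + 3) * volume.real (ball (0 : Rn n) 1)) ≤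
      ∫ x in S, |‖x - b‖ ^ 2 - 1| := by
  set w := volume.real (ball (0 : Rn n) 1) with hw
  have hw0 : 0 < w := volume_real_unitBall_pos n
  set a := volume.real S with ha
  have ha0 : 0 ≤ a := measureReal_nonneg
  have hn1 : (1 : ℝ) ≤ n := by exact_mod_cast hn
  have h2n : (1 : ℝ) ≤ 2 ^ n := one_le_pow₀ (by norm_num)
  have habs : IntegrableOn (fun x => |‖x - b‖ ^ 2 - 1|) S := hint.abs
  set η := a / (n * 2 ^ (n + 2) * w) with hη
  have hη0 : 0 ≤ η := by positivity
  have hη1 : η ≤ 1 := by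
    rw [hη, div_le_one (by positivity), pow_add]
    nlinarith [mul_le_mul hn1 h2n (by norm_num) (by positivity)]
  set N := ball b (1 + η) \ ball b (1 - η) with hN
  have hNm : MeasurableSet N := measurableSet_ball.diff measurableSet_ball
  have hNv : volume.real N ≤ n * 2 ^ n * (2 * η) * w := by
    have h1 : volume N = volume (ball (0 : Rn n) (1 + η) \ ball 0 (1 - η)) := by
      rw [← measure_preimage_add_right volume b]
      congr 1
      ext x
      simp [hN, dist_eq_norm]
    have h2 := volume_ball_diff_ball_le hn (a := 1 - η) (b := 1 + η) (by linarith) (by linarith)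
      (by linarith)
    rw [Measure.real, h1]
    refine (ENNReal.toReal_mono (ENNReal.mul_ne_top (by finiteness) measure_ball_lt_top.ne)
      h2).trans_eq ?_
    rw [ENNReal.toReal_mul, ENNReal.toReal_ofReal (by
      refine mul_nonneg (by positivity) (by linarith)), hw, Measure.real]
    ring
  have hlow : ∀ x ∈ S \ N, η ≤ |‖x - b‖ ^ 2 - 1| := by
    rintro x ⟨-, hx⟩
    have hx0 := norm_nonneg (x - b)
    simp only [hN, Set.mem_sdiff, mem_ball, dist_eq_norm, not_and, not_lt] at hx
    rcases lt_or_ge ‖x - b‖ (1 + η) with h | h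
    · have h' : ‖x - b‖ < 1 - η := by
        by_contra! h'
        exact absurd h' (hx h)
      rw [abs_of_nonpos (by nlinarith)]
      nlinarith
    · rw [abs_of_nonneg (by nlinarith)]
      nlinarith
  have hSN : a - volume.real N ≤ volume.real (S \ N) := by
    have := measureReal_sdiff_add_inter (μ := volume) (s := S) hNm hSt
    have h2 : volume.real (S ∩ N) ≤ volume.real N :=
      measureReal_mono inter_subset_right
        (measure_ne_top_of_subset sdiff_subset measure_ball_lt_top.ne)
    linarith
  calc a ^ 2 / (n * 2 ^ (n + 3) * w) = η * (a / 2) := by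
        rw [hη]; field_simp; ring
    _ ≤ η * (a - n * 2 ^ n * (2 * η) * w) := by
        gcongr
        have : n * 2 ^ n * (2 * η) * w = a / 2 := by rw [hη]; field_simp; ring
        linarith
    _ ≤ η * volume.real (S \ N) := by
        gcongr
        linarith
    _ ≤ ∫ x in S \ N, |‖x - b‖ ^ 2 - 1| := by
        have := setIntegral_ge_of_const_le_real (hS.diff hNm)
          (measure_ne_top_of_subset sdiff_subset hSt) hlow (habs.mono_set sdiff_subset)
        linarith
    _ ≤ ∫ x in S, |‖x - b‖ ^ 2 - 1| :=
        setIntegral_mono_set habs (.of_forall fun x => abs_nonneg _)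
          sdiff_subset.eventuallyLE

theorem setIntegral_sub_setIntegral_ball {n : ℕ} {F : Set (Rn n)} (hF : MeasurableSet F)
    {b : Rn n} (hint : IntegrableOn (fun x => ‖x - b‖ ^ 2 - 1) F) :
    (∫ x in F, (‖x - b‖ ^ 2 - 1)) - ∫ x in ball b 1, (‖x - b‖ ^ 2 - 1) =
      ∫ x in F ∆ ball b 1, |‖x - b‖ ^ 2 - 1| := by
  have hV : MeasurableSet (ball b 1) := measurableSet_ball
  have hintV : IntegrableOn (fun x => ‖x - b‖ ^ 2 - 1) (ball b 1) :=
    ((by fun_prop : Continuous fun x => ‖x - b‖ ^ 2 - 1).continuousOn.integrableOn_compact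
      (isCompact_closedBall b 1)).mono_set ball_subset_closedBall
  have habs : IntegrableOn (fun x => |‖x - b‖ ^ 2 - 1|) F := hint.abs
  have habsV : IntegrableOn (fun x => |‖x - b‖ ^ 2 - 1|) (ball b 1) := hintV.abs
  rw [Set.symmDiff_def, setIntegral_union (disjoint_sdiff_sdiff) (hV.diff hF)
    (habs.mono_set sdiff_subset) (habsV.mono_set sdiff_subset),
    ← integral_inter_add_sdiff hV hint, ← integral_inter_add_sdiff hF hintV, inter_comm]
  have h1 : ∫ x in F \ ball b 1, |‖x - b‖ ^ 2 - 1| = ∫ x in F \ ball b 1, (‖x - b‖ ^ 2 - 1) :=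
    setIntegral_congr_fun (hF.diff hV) fun x hx => by
      have h := hx.2
      simp only [mem_ball, dist_eq_norm, not_lt] at h
      exact abs_of_nonneg (by nlinarith)
  have h2 : ∫ x in ball b 1 \ F, |‖x - b‖ ^ 2 - 1| = -∫ x in ball b 1 \ F, (‖x - b‖ ^ 2 - 1) := by
    rw [← integral_neg]
    refine setIntegral_congr_fun (hV.diff hF) fun x hx => ?_
    have h := hx.1
    simp only [mem_ball, dist_eq_norm] at h
    exact abs_of_nonpos (by nlinarith [norm_nonneg (x - b)])
  rw [h1, h2]
  ring

theorem exists_half_volume_inter_ball {n : ℕ} {E : Set (Rn n)} (hE : MeasurableSet E)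
    (hEt : volume E ≠ ∞) (h : truncMoment E < ENNReal.ofReal (3 * volume.real E ^ 2)) :
    ∃ x₀, volume.real E / 2 ≤ volume.real (E ∩ ball x₀ 2.5) := by
  by_contra! hcon
  refine h.not_ge ?_
  have m1 : Measurable fun r : ℝ => ENNReal.ofReal (min (r ^ 2) 100) := by fun_prop
  rw [truncMoment, interaction_eq_iterated m1]
  calc ENNReal.ofReal (3 * volume.real E ^ 2)
      = ∫⁻ x in E, ENNReal.ofReal (3 * volume.real E) := by
        rw [setLIntegral_const, ← ofReal_measureReal hEt, ← ENNReal.ofReal_mul (by positivity)]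
        congr 1
        ring
    _ ≤ _ := lintegral_mono fun x => ?_
  have hx := measureReal_sdiff_add_inter (μ := volume) (s := E)
    (measurableSet_ball (x := x) (ε := 2.5)) hEt
  have hx' := hcon x
  calc ENNReal.ofReal (3 * volume.real E)
      ≤ ENNReal.ofReal (6.25 * volume.real (E \ ball x 2.5)) := by
        refine ENNReal.ofReal_le_ofReal ?_
        have : 0 ≤ volume.real E := measureReal_nonneg
        linarith
    _ = ∫⁻ y in E \ ball x 2.5, ENNReal.ofReal 6.25 := by
        rw [setLIntegral_const, ENNReal.ofReal_mul (by norm_num),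
          ofReal_measureReal (measure_ne_top_of_subset sdiff_subset hEt)]
    _ ≤ ∫⁻ y in E \ ball x 2.5, ENNReal.ofReal (min (‖x - y‖ ^ 2) 100) := by
        refine setLIntegral_mono' (hE.diff measurableSet_ball) fun y hy => ?_
        have h2 := hy.2
        rw [mem_ball', dist_eq_norm, not_lt] at h2
        refine ENNReal.ofReal_le_ofReal (le_min ?_ (by norm_num))
        nlinarith
    _ ≤ _ := lintegral_mono_set sdiff_subset

theorem truncMoment_inter_ball_add_le {n : ℕ} {E : Set (Rn n)} (hE : MeasurableSet E) (x₀ : Rn n) :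
    truncMoment (E ∩ ball x₀ 5) +
      ENNReal.ofReal 12.5 * (volume (E \ ball x₀ 5) * volume (E ∩ ball x₀ 2.5)) ≤
      truncMoment E := by
  set F := E ∩ ball x₀ 5
  set T := E \ ball x₀ 5
  set C := E ∩ ball x₀ 2.5
  have hF : MeasurableSet F := hE.inter measurableSet_ball
  have hT : MeasurableSet T := hE.diff measurableSet_ball
  have hC : MeasurableSet C := hE.inter measurableSet_ball
  have hCF : C ⊆ F := inter_subset_inter_right _ (ball_subset_ball (by norm_num))
  have hFT : Disjoint F T := disjoint_sdiff_inter.symm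
  have hfar : ∀ p ∈ T, ∀ q ∈ C, 2.5 ≤ ‖p - q‖ := by
    intro p hp q hq
    have h1 := hp.2
    have h2 := hq.2
    rw [mem_ball, not_lt] at h1
    rw [mem_ball] at h2
    have h3 := dist_triangle p q x₀
    rw [dist_eq_norm p q] at h3
    norm_num at *
    linarith
  have hk : ∀ r : ℝ, 2.5 ≤ r → ENNReal.ofReal 6.25 ≤ ENNReal.ofReal (min (r ^ 2) 100) := by
    intro r hr
    exact ENNReal.ofReal_le_ofReal (le_min (by nlinarith) (by norm_num))
  have h1 : ENNReal.ofReal 6.25 * (volume T * volume C) ≤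
      interaction (fun r => ENNReal.ofReal (min (r ^ 2) 100)) T C := by
    rw [← Measure.prod_prod, ← setLIntegral_const]
    exact setLIntegral_mono' (hT.prod hC) fun p hp => hk _ (hfar _ hp.1 _ hp.2)
  have h2 : ENNReal.ofReal 6.25 * (volume T * volume C) ≤
      interaction (fun r => ENNReal.ofReal (min (r ^ 2) 100)) C T := by
    rw [mul_comm (volume T), ← Measure.prod_prod, ← setLIntegral_const]
    refine setLIntegral_mono' (hC.prod hT) fun p hp => hk _ ?_
    rw [norm_sub_rev]
    exact hfar _ hp.2 _ hp.1
  have h3 : ENNReal.ofReal 12.5 = ENNReal.ofReal 6.25 + ENNReal.ofReal 6.25 := by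
    rw [← ENNReal.ofReal_add (by norm_num) (by norm_num)]
    norm_num
  have d1 : Disjoint (T ×ˢ C) (C ×ˢ T) :=
    Set.disjoint_prod.2 (.inl (hFT.symm.mono_right hCF))
  have d2 : Disjoint (F ×ˢ F) (T ×ˢ C ∪ C ×ˢ T) :=
    disjoint_union_right.2 ⟨Set.disjoint_prod.2 (.inl hFT), Set.disjoint_prod.2 (.inr hFT)⟩
  calc _ ≤ truncMoment F + (interaction (fun r => ENNReal.ofReal (min (r ^ 2) 100)) T C +
        interaction (fun r => ENNReal.ofReal (min (r ^ 2) 100)) C T) := by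
        rw [h3, add_mul]
        gcongr
    _ = ∫⁻ p in F ×ˢ F ∪ (T ×ˢ C ∪ C ×ˢ T), ENNReal.ofReal (min (‖p.1 - p.2‖ ^ 2) 100)
        ∂(volume.prod volume) := by
        rw [lintegral_union ((hT.prod hC).union (hC.prod hT)) d2,
          lintegral_union (hC.prod hT) d1, truncMoment, interaction, interaction, interaction]
    _ ≤ truncMoment E := by
        refine lintegral_mono_set ?_
        have f : F ⊆ E := inter_subset_left
        have t : T ⊆ E := sdiff_subset
        exact union_subset (prod_mono f f)
          (union_subset (prod_mono t (hCF.trans f)) (prod_mono (hCF.trans f) t))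

theorem setIntegral_ball_norm_sub_sq {n : ℕ} (b : Rn n) :
    ∫ x in ball b 1, ‖x - b‖ ^ 2 = ∫ x in ball (0 : Rn n) 1, ‖x‖ ^ 2 := by
  have h := (measurePreserving_sub_right volume b).setIntegral_preimage_emb
    (MeasurableEquiv.subRight b).measurableEmbedding (fun x => ‖x‖ ^ 2) (ball 0 1)
  have h2 : (fun x => x - b) ⁻¹' ball (0 : Rn n) 1 = ball b 1 := by
    ext x
    simp [dist_eq_norm]
  rwa [h2] at h

theorem setIntegral_ball_self (n : ℕ) : ∫ x in ball (0 : Rn n) 1, x = 0 := by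
  have h := (Measure.measurePreserving_neg (volume : Measure (Rn n))).setIntegral_preimage_emb
    (MeasurableEquiv.neg (Rn n)).measurableEmbedding (fun x => x) (ball 0 1)
  have h2 : Neg.neg ⁻¹' ball (0 : Rn n) 1 = ball 0 1 := by
    ext x
    simp
  rw [h2, integral_neg] at h
  have h3 : (2 : ℝ) • ∫ x in ball (0 : Rn n) 1, x = 0 := by
    rw [two_smul]
    nth_rw 1 [← h]
    exact neg_add_cancel _
  exact (smul_eq_zero_iff_right two_ne_zero).1 h3

theorem truncMoment_ball {n : ℕ} : truncMoment (ball (0 : Rn n) 1) =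
    ENNReal.ofReal (2 * volume.real (ball (0 : Rn n) 1) * ∫ x in ball (0 : Rn n) 1, ‖x‖ ^ 2) := by
  simpa using truncMoment_eq_of_barycenter (x₀ := 0) (b := 0) measurableSet_ball
    (ball_subset_ball (by norm_num : (1 : ℝ) ≤ 5)) (by simpa using setIntegral_ball_self n)

theorem setIntegral_ball_norm_sq_le {n : ℕ} :
    ∫ x in ball (0 : Rn n) 1, ‖x‖ ^ 2 ≤ volume.real (ball (0 : Rn n) 1) := by
  have hint : IntegrableOn (fun x : Rn n => ‖x‖ ^ 2) (ball 0 1) :=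
    ((by fun_prop : Continuous fun x : Rn n => ‖x‖ ^ 2).continuousOn.integrableOn_compact
      (isCompact_closedBall 0 1)).mono_set ball_subset_closedBall
  have hc : IntegrableOn (fun _ : Rn n => (1 : ℝ)) (ball 0 1) :=
    integrableOn_const measure_ball_lt_top.ne
  have := setIntegral_mono_on hint hc measurableSet_ball fun x hx => by
    rw [mem_ball_zero_iff] at hx
    exact pow_le_one₀ (norm_nonneg x) hx.le
  simpa using this

theorem add_sq_le_of_le {w M t D a c v : ℝ} (hw : 0 ≤ w) (hc : 0 ≤ c) (hc1 : c ≤ 1 / 4)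
    (ht : 0 ≤ t) (htw : t ≤ w / 2) (hM : M ≤ w) (hD : 0 ≤ D) (hv : w / 2 ≤ v)
    (ha : 2 * c * a ^ 2 ≤ w * D) :
    2 * w * M + c * (a + t) ^ 2 ≤ 2 * (w - t) * (M - t + D) + 12.5 * (t * v) := by
  have h1 : t * (w / 2) ≤ t * v := by gcongr
  have h2 : c * (a + t) ^ 2 ≤ c * (2 * a ^ 2 + 2 * t ^ 2) := by
    gcongr
    nlinarith [sq_nonneg (a - t)]
  have h3 : c * t ^ 2 ≤ 1 / 4 * t ^ 2 := by gcongr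
  have h4 : t * t ≤ t * (w / 2) := by gcongr
  have h5 : t * D ≤ w / 2 * D := by gcongr
  have h6 : t * M ≤ t * w := by gcongr
  have h7 : 0 ≤ t * w := by positivity
  nlinarith

/-- Quantitative minimality of the ball for the truncated second moment among sets of given
volume. -/
theorem exists_truncMoment_ball_add_le {n : ℕ} (hn : 0 < n) {E : Set (Rn n)}
    (hE : MeasurableSet E) (hvol : volume E = volume (ball (0 : Rn n) 1)) :
    ∃ b : Rn n, truncMoment (ball (0 : Rn n) 1) +
      ENNReal.ofReal (1 / (n * 2 ^ (n + 4))) * volume (E ∆ ball b 1) ^ 2 ≤ truncMoment E := by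
  set w := volume.real (ball (0 : Rn n) 1) with hw
  set M := ∫ x in ball (0 : Rn n) 1, ‖x‖ ^ 2 with hM
  set c := 1 / ((n : ℝ) * 2 ^ (n + 4)) with hc
  have hw0 : 0 < w := volume_real_unitBall_pos n
  have hM0 : 0 ≤ M := integral_nonneg fun x => by positivity
  have hMw : M ≤ w := setIntegral_ball_norm_sq_le
  have hn1 : (1 : ℝ) ≤ n := by exact_mod_cast hn
  have hc0 : 0 < c := by positivity
  have hc1 : c ≤ 1 / 4 := by
    rw [hc]
    refine one_div_le_one_div_of_le (by norm_num) ?_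
    have h2n : (1 : ℝ) ≤ 2 ^ n := one_le_pow₀ (by norm_num)
    rw [pow_add]
    nlinarith [mul_le_mul hn1 h2n (by norm_num) (by positivity)]
  have hEt : volume E ≠ ∞ := by rw [hvol]; exact measure_ball_lt_top.ne
  have hEw : volume.real E = w := by rw [Measure.real, hvol, hw, Measure.real]
  rw [truncMoment_ball, ← hw, ← hM]
  have key : ∀ (b : Rn n) (r : ℝ), volume (E ∆ ball b 1) ≤ ENNReal.ofReal r → 0 ≤ r →
      ENNReal.ofReal (2 * w * M) + ENNReal.ofReal c * volume (E ∆ ball b 1) ^ 2 ≤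
        ENNReal.ofReal (2 * w * M + c * r ^ 2) := by
    intro b r hr hr0
    rw [ENNReal.ofReal_add (by positivity) (by positivity), ENNReal.ofReal_mul hc0.le,
      ENNReal.ofReal_pow hr0]
    gcongr
  by_cases hlarge : ENNReal.ofReal (3 * volume.real E ^ 2) ≤ truncMoment E
  · refine ⟨0, (key 0 (2 * w) ?_ (by positivity)).trans
      ((ENNReal.ofReal_le_ofReal ?_).trans hlarge)⟩
    · calc volume (E ∆ ball 0 1) ≤ volume (E ∪ ball 0 1) := measure_mono symmDiff_subset_union
        _ ≤ volume E + volume (ball (0 : Rn n) 1) := measure_union_le _ _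
        _ = _ := by
          rw [hvol, ← two_mul, ENNReal.ofReal_mul (by norm_num), hw,
            ofReal_measureReal measure_ball_lt_top.ne]
          simp
    · rw [hEw]
      nlinarith [mul_le_mul_of_nonneg_right hc1 (sq_nonneg w)]
  obtain ⟨x₀, hx₀⟩ := exists_half_volume_inter_ball hE hEt (not_le.1 hlarge)
  have hsplit := truncMoment_inter_ball_add_le hE x₀
  rw [hEw] at hx₀
  set F := E ∩ ball x₀ 5 with hFdef
  set T := E \ ball x₀ 5 with hTdef
  set C := E ∩ ball x₀ 2.5
  have hF : MeasurableSet F := hE.inter measurableSet_ball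
  have hFt : volume F ≠ ∞ := measure_ne_top_of_subset inter_subset_left hEt
  have hTt : volume T ≠ ∞ := measure_ne_top_of_subset sdiff_subset hEt
  have hCt : volume C ≠ ∞ := measure_ne_top_of_subset inter_subset_left hEt
  have hCF : volume.real C ≤ volume.real F :=
    measureReal_mono (inter_subset_inter_right _ (ball_subset_ball (by norm_num))) hFt
  set t := volume.real T with ht
  have ht0 : 0 ≤ t := measureReal_nonneg
  have hFw : volume.real F = w - t := by
    have := measureReal_sdiff_add_inter (μ := volume) (s := E)
      (measurableSet_ball (x := x₀) (ε := 5)) hEt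
    linarith
  have htw : t ≤ w / 2 := by linarith
  have hm : 0 < volume.real F := by linarith
  have hint : ∀ {G : Type} [NormedAddCommGroup G] {f : Rn n → G}, Continuous f →
      IntegrableOn f F := fun hf =>
    (hf.continuousOn.integrableOn_compact (isCompact_closedBall x₀ 5)).mono_set
      (inter_subset_right.trans ball_subset_closedBall)
  have : IsFiniteMeasure (volume.restrict F) := ⟨by simpa using hFt.lt_top⟩
  set b := (volume.real F)⁻¹ • ∫ x in F, x with hbdef
  have hb : ∫ y in F, (y - b) = 0 := by
    rw [integral_sub (f := fun y => y) (hint continuous_id) (hint continuous_const), integral_const,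
      measureReal_restrict_apply_univ, hbdef, smul_inv_smul₀ hm.ne', sub_self]
  have hFm := truncMoment_eq_of_barycenter hF inter_subset_right hb
  have hi : IntegrableOn (fun x => ‖x - b‖ ^ 2 - 1) F := hint (by fun_prop)
  set D := ∫ x in F ∆ ball b 1, |‖x - b‖ ^ 2 - 1| with hD
  set a := volume.real (F ∆ ball b 1) with ha
  have ha0 : 0 ≤ a := measureReal_nonneg
  have hcont : Continuous fun x : Rn n => ‖x - b‖ ^ 2 - 1 := by fun_prop
  have hball : ∀ {f : Rn n → ℝ}, Continuous f → IntegrableOn f (ball b 1) := fun hf =>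
    (hf.continuousOn.integrableOn_compact (isCompact_closedBall b 1)).mono_set
      ball_subset_closedBall
  have hIF : ∫ x in F, ‖x - b‖ ^ 2 = M - t + D := by
    have h1 := setIntegral_sub_setIntegral_ball hF hi
    rw [integral_sub (hint (by fun_prop)) (hint continuous_const),
      integral_sub (hball (by fun_prop)) (hball continuous_const),
      setIntegral_ball_norm_sub_sq] at h1
    simp only [integral_const, measureReal_restrict_apply_univ, smul_eq_mul, mul_one,
      volume_real_ball_one] at h1
    linarith
  have hSt : volume (F ∆ ball b 1) ≠ ∞ :=
    measure_ne_top_of_subset symmDiff_subset_union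
      (measure_union_ne_top hFt measure_ball_lt_top.ne)
  have ha2 : a ≤ 2 * w := by
    have h1 : a ≤ volume.real (F ∪ ball b 1) :=
      measureReal_mono symmDiff_subset_union (measure_union_ne_top hFt measure_ball_lt_top.ne)
    have h2 := measureReal_union_le (μ := volume) F (ball b 1)
    rw [volume_real_ball_one, ← hw] at h2
    linarith
  have hDa : 2 * c * a ^ 2 ≤ w * D := by
    have h1 := sq_le_setIntegral_abs hn (hF.symmDiff measurableSet_ball)
      ((hi.union (hball hcont)).mono_set symmDiff_subset_union) hSt ha2
    calc 2 * c * a ^ 2 = w * (a ^ 2 / (n * 2 ^ (n + 3) * w)) := by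
          rw [hc, pow_succ 2 (n + 3)]
          field_simp
      _ ≤ w * D := by gcongr
  have hD0 : 0 ≤ D := integral_nonneg fun x => abs_nonneg _
  refine ⟨b, (key b (a + t) ?_ (by positivity)).trans (le_trans ?_ hsplit)⟩
  · rw [ENNReal.ofReal_add ha0 ht0, ha, ofReal_measureReal hSt, ht, ofReal_measureReal hTt]
    refine (measure_mono ?_).trans (measure_union_le _ _)
    intro x hx
    simp only [hFdef, hTdef, Set.mem_symmDiff, Set.mem_union, Set.mem_inter_iff,
      Set.mem_sdiff] at hx ⊢
    tauto
  · rw [hFm, hIF, ← ofReal_measureReal hTt, ← ofReal_measureReal hCt,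
      ← ENNReal.ofReal_mul (by positivity), ← ENNReal.ofReal_mul (by norm_num),
      ← ENNReal.ofReal_add ?_ (by positivity), hFw]
    · refine ENNReal.ofReal_le_ofReal ?_
      linarith [add_sq_le_of_le hw0.le hc0.le hc1 ht0 htw hMw hD0 hx₀ hDa]
    · have : 0 ≤ ∫ x in F, ‖x - b‖ ^ 2 := integral_nonneg fun x => by positivity
      rw [← hIF]
      positivity

/-- **`L¹`-closeness of minimizers to the unit ball.** If minimizers of
`min { P_s(E) + ε V_s(E) : |E| = ω_n }` exist for `ε ∈ (0,ε₀]`, then there is `γ(n,s) > 0`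
such that every minimizer `E_ε`, for `ε ∈ (0,ε₀]`, satisfies `|(E_ε - x_ε) Δ B₁| ≤ γ ε^{1/2}`
for some `x_ε ∈ ℝⁿ`. -/
theorem stmt_13 (n : ℕ) (hn : 2 ≤ n) (s : ℝ) (hs : s ∈ Set.Ioo (0 : ℝ) 1)
    (ε₀ : ℝ) (hε₀ : 0 < ε₀)
    (hex : ∀ ε ∈ Set.Ioc (0 : ℝ) ε₀, ∃ E : Set (Rn n), IsEnergyMin n s ε E) :
    ∃ γ : ℝ, 0 < γ ∧ ∀ ε ∈ Set.Ioc (0 : ℝ) ε₀, ∀ E : Set (Rn n), IsEnergyMin n s ε E →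
      ∃ x : Rn n,
        volume (((· + x) ⁻¹' E) ∆ ball (0 : Rn n) 1) ≤ ENNReal.ofReal (γ * Real.sqrt ε) := by
  obtain ⟨hs0, hs1⟩ := hs
  set B := ball (0 : Rn n) 1 with hB
  set c : ℝ := 10 ^ (-((n : ℝ) + s) - 2) with hc
  set c' : ℝ := 1 / (n * 2 ^ (n + 4)) with hc'
  have hn0 : 0 < n := by lia
  have hc0 : 0 < c := by positivity
  have hc0' : 0 < c' := by positivity
  have hV := Vs_ball_ne_top hn hs0 hs1
  set V := (Vs n s B).toReal with hVdef
  have hV0 : 0 ≤ V := ENNReal.toReal_nonneg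
  refine ⟨Real.sqrt (V / (c * c')) + 1, by positivity, fun ε hε E hE => ?_⟩
  obtain ⟨hEm, hEv, hmin⟩ := hE
  obtain ⟨b, hb⟩ := exists_truncMoment_ball_add_le hn0 hEm hEv
  refine ⟨b, ?_⟩
  have hBt : truncMoment B ≠ ∞ := by
    rw [truncMoment_ball]
    exact ENNReal.ofReal_ne_top
  have hP := fracPer_ball_ne_top hn hs0 hs1
  have h1 : fracPer n s E ≤ fracPer n s B + ENNReal.ofReal ε * Vs n s B :=
    le_self_add.trans (hmin B measurableSet_ball rfl)
  have h2 := (fracPer_ball_add_le hn hs0 hEm hEv).trans (add_le_add_left h1 _)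
  rw [add_assoc, ENNReal.add_le_add_iff_left hP,
    add_comm (ENNReal.ofReal ε * _)] at h2
  have h3 := (mul_le_mul_right hb (ENNReal.ofReal c)).trans h2
  rw [mul_add, ENNReal.add_le_add_iff_left (ENNReal.mul_ne_top ENNReal.ofReal_ne_top hBt),
    ← mul_assoc, ← ENNReal.ofReal_mul hc0.le, ← ENNReal.ofReal_toReal hV, ← hVdef,
    ← ENNReal.ofReal_mul hε.1.le] at h3
  have hDt : volume (E ∆ ball b 1) ≠ ∞ :=
    measure_ne_top_of_subset symmDiff_subset_union
      (measure_union_ne_top (by rw [hEv]; exact measure_ball_lt_top.ne) measure_ball_lt_top.ne)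
  have h4 : volume (((· + b) ⁻¹' E) ∆ B) = volume (E ∆ ball b 1) := by
    rw [← measure_preimage_add_right volume b (E ∆ ball b 1)]
    congr 1
    ext x
    simp [hB, Set.mem_symmDiff, dist_eq_norm]
  rw [h4, ← ofReal_measureReal hDt]
  rw [← ofReal_measureReal hDt, ← ENNReal.ofReal_pow measureReal_nonneg,
    ← ENNReal.ofReal_mul (by positivity), ENNReal.ofReal_le_ofReal_iff
    (mul_nonneg hε.1.le hV0)] at h3
  refine ENNReal.ofReal_le_ofReal ?_
  calc volume.real (E ∆ ball b 1) ≤ Real.sqrt (V / (c * c') * ε) := by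
        refine Real.le_sqrt_of_sq_le ?_
        rw [div_mul_eq_mul_div, le_div_iff₀ (by positivity)]
        linarith
    _ = Real.sqrt (V / (c * c')) * Real.sqrt ε := Real.sqrt_mul (by positivity) _
    _ ≤ _ := by
        gcongr
        linarith
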